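/- arXiv:2102.07967 — 4 statements merged into one kernel-verified Lean document; each statement's English description precedes it below -/
import Mathlib

section
/- Let α ∈ (0,1), d ≥ 1, n₁, n₂ ≥ 1 and n = n₁ + n₂. Let P be any probability distribution on ℝ^d × ℝ and let (X₁,Y₁),…,(X_{n+1},Y_{n+1}) be i.i.d. with law P. Let A be a map sending each dataset of n₁ points in ℝ^d × ℝ to a measurable function ℝ^d → ℝ, and set μ̂ = A((X₁,Y₁),…,(X_{n₁},Y_{n₁})). For n₁ < i ≤ n set E_i = |Y_i − μ̂(X_i)|, and let Q be the ⌈(1−α/2)(n₂+1)⌉-th smallest value of the multiset {E_i : n₁ < i ≤ n} (with Q = +∞ if ⌈(1−α/2)(n₂+1)⌉ > n₂). Assume the coverage event below is measurable. Then for every conditional median function m of P, ℙ( μ̂(X_{n+1}) − Q ≤ m(X_{n+1}) ≤ μ̂(X_{n+1}) + Q ) ≥ 1 − α. -/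
open MeasureTheory ProbabilityTheory
open scoped ENNReal NNReal

/-- The `k`-th smallest value (1-indexed) of the multiset `{E i : i}`, as an extended real:
`⊥` if `k ≤ 0` and `⊤` if `k > N`. -/
noncomputable def kthSmallest {N : ℕ} (E : Fin N → ℝ) (k : ℤ) : EReal :=
  if k ≤ 0 then ⊥
  else if (N : ℤ) < k then ⊤
  else (((Multiset.map E Finset.univ.val).sort (· ≤ ·)).getD (k.toNat - 1) 0 : ℝ)

/-- `m` is a conditional median function for `P`. -/
def IsCondMedian {d : ℕ} (P : Measure ((Fin d → ℝ) × ℝ)) [IsFiniteMeasure P]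
    (m : (Fin d → ℝ) → ℝ) : Prop :=
  Measurable m ∧
    ∀ᵐ x ∂P.fst, (1 : ℝ≥0∞) / 2 ≤ P.condKernel x (Set.Iic (m x)) ∧
      (1 : ℝ≥0∞) / 2 ≤ P.condKernel x (Set.Ici (m x))

/-- `g` is a conditional `q`-quantile function for `P`. -/
def IsCondQuantile {d : ℕ} (q : ℝ) (P : Measure ((Fin d → ℝ) × ℝ)) [IsFiniteMeasure P]
    (g : (Fin d → ℝ) → ℝ) : Prop :=
  Measurable g ∧
    ∀ᵐ x ∂P.fst, ENNReal.ofReal q ≤ P.condKernel x (Set.Iic (g x)) ∧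
      ENNReal.ofReal (1 - q) ≤ P.condKernel x (Set.Ici (g x))

/-- The event that the split conformal interval built from absolute residuals covers the
value `m(X_{n+1})`.  Datapoints are indexed by `Fin (n₁ + n₂ + 1)`: the first `n₁` are the
training set, the next `n₂` the calibration set, and the last one is the test point. -/
def medianCoverageEvent {d n₁ n₂ : ℕ} (α : ℝ)
    (A : (Fin n₁ → ((Fin d → ℝ) × ℝ)) → (Fin d → ℝ) → ℝ) (m : (Fin d → ℝ) → ℝ) :
    Set (Fin (n₁ + n₂ + 1) → ((Fin d → ℝ) × ℝ)) :=
  {ω |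
    let muhat : (Fin d → ℝ) → ℝ := A fun i : Fin n₁ => ω (Fin.castLE (by omega) i)
    let Q : EReal := kthSmallest
      (fun j : Fin n₂ =>
        |(ω ⟨n₁ + j.1, by have := j.2; omega⟩).2 - muhat (ω ⟨n₁ + j.1, by have := j.2; omega⟩).1|)
      ⌈(1 - α / 2) * ((n₂ : ℝ) + 1)⌉
    (muhat (ω (Fin.last (n₁ + n₂))).1 : EReal) - Q ≤ (m (ω (Fin.last (n₁ + n₂))).1 : EReal) ∧
      (m (ω (Fin.last (n₁ + n₂))).1 : EReal) ≤ (muhat (ω (Fin.last (n₁ + n₂))).1 : EReal) + Q}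

/-- If the `k`-th smallest value lies below `t`, at least `k` of the values lie below `t`. -/
theorem le_card_filter_lt_of_kthSmallest_lt {N : ℕ} {E : Fin N → ℝ} {k : ℤ} {t : ℝ}
    (h : kthSmallest E k < t) :
    k.toNat ≤ (Finset.univ.filter fun j => E j < t).card := by
  unfold kthSmallest at h
  split_ifs at h with h0 hN
  · simp [Int.toNat_of_nonpos h0]
  · simp at h
  set l := (Multiset.map E Finset.univ.val).sort (· ≤ ·) with hl
  have hlen : l.length = N := by simp [hl]
  have hlt : k.toNat - 1 < l.length := by omega
  rw [List.getD_eq_getElem _ _ hlt, EReal.coe_lt_coe_iff] at h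
  have hsorted : l.Pairwise (· ≤ ·) := Multiset.pairwise_sort _ _
  have hcard : (Finset.univ.filter fun j => E j < t).card = l.countP (fun x => x < t) := by
    rw [← Multiset.coe_countP, hl, Multiset.sort_eq, Multiset.countP_map]
    simp [Finset.card_def]
  have htake : (l.take k.toNat).countP (fun x => x < t) = (l.take k.toNat).length := by
    rw [List.countP_eq_length]
    intro a ha
    obtain ⟨i, hi, rfl⟩ := List.getElem_of_mem ha
    have hik : i < k.toNat := by
      rw [List.length_take] at hi
      omega
    rw [List.getElem_take]
    exact decide_eq_true <| (hsorted.sortedLE.getElem_le_getElem_of_le (by omega)).trans_lt h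
  calc k.toNat = (l.take k.toNat).length := by rw [List.length_take]; omega
    _ = (l.take k.toNat).countP (fun x => x < t) := htake.symm
    _ ≤ l.countP (fun x => x < t) := (List.take_sublist _ _).countP_le
    _ = _ := hcard.symm

/-- At most `N - k` of `N` values have at least `k` values strictly below them. -/
theorem card_filter_le_card_filter_lt {ι : Type*} [Fintype ι] (e : ι → ℝ) (k : ℕ) :
    (Finset.univ.filter fun i => k ≤ (Finset.univ.filter fun j => e j < e i).card).card
      ≤ Fintype.card ι - k := by
  classical
  set S := Finset.univ.filter fun i => k ≤ (Finset.univ.filter fun j => e j < e i).card with hS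
  rcases S.eq_empty_or_nonempty with h | h
  · simp [h]
  obtain ⟨i₀, hi₀, hmin⟩ := S.exists_min_image e h
  have hk : k ≤ (Finset.univ.filter fun j => e j < e i₀).card := by simpa [hS] using hi₀
  have hdisj : Disjoint S (Finset.univ.filter fun j => e j < e i₀) := by
    rw [Finset.disjoint_left]
    intro i hi hlt
    exact absurd (Finset.mem_filter.mp hlt).2 (not_lt.mpr (hmin i hi))
  have := Finset.card_le_univ (S ∪ Finset.univ.filter fun j => e j < e i₀)
  rw [Finset.card_union_of_disjoint hdisj] at this
  omega

theorem measurableSet_le_card_filter {Ω ι : Type*} [MeasurableSpace Ω] [Fintype ι]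
    {p : ι → Ω → Prop} [∀ ω, DecidablePred fun i => p i ω]
    (hp : ∀ i, MeasurableSet {ω | p i ω}) (k : ℕ) :
    MeasurableSet {ω | k ≤ (Finset.univ.filter fun i => p i ω).card} := by
  simp_rw [Finset.card_filter]
  exact measurableSet_le measurable_const <| Finset.measurable_sum _ fun i _ =>
    Measurable.ite (hp i) measurable_const measurable_const

/-- Under an i.i.d. sample, a fixed score has at least `k` scores strictly below it with
probability at most `(N - k) / N`. -/
theorem card_mul_pi_le_card_filter_lt {Z ι : Type*} [MeasurableSpace Z] [Fintype ι]
    (P : Measure Z) [IsProbabilityMeasure P] {E : Z → ℝ} (hE : Measurable E) (k : ℕ) (i : ι) :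
    (Fintype.card ι : ℝ≥0∞) * (Measure.pi fun _ : ι => P)
        {ω | k ≤ (Finset.univ.filter fun j => E (ω j) < E (ω i)).card}
      ≤ (Fintype.card ι - k : ℕ) := by
  classical
  set ν := Measure.pi fun _ : ι => P
  let B : ι → Set (ι → Z) := fun i =>
    {ω | k ≤ (Finset.univ.filter fun j => E (ω j) < E (ω i)).card}
  have hB : ∀ i, MeasurableSet (B i) := fun i =>
    measurableSet_le_card_filter (fun j => measurableSet_lt
      (hE.comp (measurable_pi_apply j)) (hE.comp (measurable_pi_apply i))) k
  have hsymm : ∀ i', ν (B i') = ν (B i) := by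
    intro i'
    let σ : Equiv.Perm ι := Equiv.swap i i'
    have hmp : MeasurePreserving (fun ω : ι → Z => fun j => ω (σ j)) ν ν := by
      have := (measurePreserving_piCongrLeft (fun _ : ι => P) σ).symm
      exact this
    rw [← hmp.measure_preimage (hB i).nullMeasurableSet]
    congr 1
    ext ω
    simp only [B, Set.mem_ofPred_eq, Set.mem_preimage, σ, Equiv.swap_apply_left]
    rw [← Finset.card_map (Equiv.swap i i').toEmbedding]
    refine Eq.to_iff (congrArg (k ≤ ·) (congrArg Finset.card ?_))
    ext j
    simp [Finset.mem_map_equiv]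
  have hsum : (Fintype.card ι : ℝ≥0∞) * ν (B i) = ∑ i', ν (B i') := by
    simp [hsymm]
  calc (Fintype.card ι : ℝ≥0∞) * ν (B i)
      = ∑ i', ∫⁻ ω, (B i').indicator 1 ω ∂ν := by
        rw [hsum]; simp_rw [lintegral_indicator_one (hB _)]
    _ = ∫⁻ ω, ∑ i', (B i').indicator 1 ω ∂ν :=
        (lintegral_finsetSum _ fun i' _ => measurable_one.indicator (hB i')).symm
    _ ≤ ∫⁻ _, ((Fintype.card ι - k : ℕ) : ℝ≥0∞) ∂ν := by
        refine lintegral_mono fun ω => ?_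
        have h := card_filter_le_card_filter_lt (fun j => E (ω j)) k
        have hcount : ∑ i', (B i').indicator (1 : (ι → Z) → ℝ≥0∞) ω =
            ((Finset.univ.filter fun i' =>
              k ≤ (Finset.univ.filter fun j => E (ω j) < E (ω i')).card).card : ℝ≥0∞) := by
          simp [B, Set.indicator_apply, Finset.sum_boole]
        rw [hcount]
        exact Nat.cast_le.mpr h
    _ = _ := by simp

/-- Given `X`, the residual at `f` is at least `|m X - f X|` with probability at least `1/2`. -/
theorem IsCondMedian.fst_le_two_mul {d : ℕ} {P : Measure ((Fin d → ℝ) × ℝ)}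
    [IsProbabilityMeasure P] {m f : (Fin d → ℝ) → ℝ} (hm : IsCondMedian P m) (hf : Measurable f)
    {M : Set (Fin d → ℝ)} (hM : MeasurableSet M) :
    P (Prod.fst ⁻¹' M) ≤
      2 * P (Prod.fst ⁻¹' M ∩ {z | |m z.1 - f z.1| ≤ |z.2 - f z.1|}) := by
  have hmm := hm.1
  have hS : MeasurableSet
      (Prod.fst ⁻¹' M ∩ {z : (Fin d → ℝ) × ℝ | |m z.1 - f z.1| ≤ |z.2 - f z.1|}) :=
    (measurable_fst hM).inter (measurableSet_le (by fun_prop) (by fun_prop))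
  rw [← Measure.fst_apply hM, ← lintegral_indicator_one hM,
    ← Measure.lintegral_condKernel_mem hS,
    ← lintegral_const_mul' _ _ (by simp)]
  refine lintegral_mono_ae ?_
  filter_upwards [hm.2] with x ⟨hle, hge⟩
  by_cases hx : x ∈ M
  · have hhalf : (1 : ℝ≥0∞) / 2 ≤ P.condKernel x
        {y | (x, y) ∈ Prod.fst ⁻¹' M ∩
          {z : (Fin d → ℝ) × ℝ | |m z.1 - f z.1| ≤ |z.2 - f z.1|}} := by
      rcases le_total (f x) (m x) with h | h
      · refine hge.trans (measure_mono fun y hy => ⟨hx, ?_⟩)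
        exact abs_le_abs_of_nonneg (sub_nonneg.mpr h) (sub_le_sub_right hy _)
      · refine hle.trans (measure_mono fun y hy => ⟨hx, ?_⟩)
        exact abs_le_abs_of_nonpos (sub_nonpos.mpr h) (sub_le_sub_right hy _)
    calc M.indicator 1 x = 2 * ((1 : ℝ≥0∞) / 2) := by
          simp [hx, ENNReal.mul_inv_cancel]
      _ ≤ _ := by gcongr
  · simp [hx]

/-- The first coordinates and the last coordinate of an i.i.d. sample are independent. -/
theorem measurePreserving_snoc {Z : Type*} [MeasurableSpace Z] (P : Measure Z)
    [IsProbabilityMeasure P] (n : ℕ) :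
    MeasurePreserving (fun q : (Fin n → Z) × Z => (Fin.snoc q.1 q.2 : Fin (n + 1) → Z))
      ((Measure.pi fun _ : Fin n => P).prod P) (Measure.pi fun _ : Fin (n + 1) => P) := by
  have hmeas : Measurable fun q : (Fin n → Z) × Z => (Fin.snoc q.1 q.2 : Fin (n + 1) → Z) := by
    refine measurable_pi_lambda _ fun i => ?_
    induction i using Fin.lastCases <;> simp <;> fun_prop
  refine ⟨hmeas, (Measure.pi_eq fun s hs => ?_).symm⟩
  have hpre : (fun q : (Fin n → Z) × Z => (Fin.snoc q.1 q.2 : Fin (n + 1) → Z)) ⁻¹'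
      Set.univ.pi s = (Set.univ.pi fun i => s (Fin.castSucc i)) ×ˢ s (Fin.last n) := by
    ext q
    simp [Set.mem_pi, Fin.forall_fin_succ']
  rw [Measure.map_apply hmeas (.univ_pi hs), hpre, Measure.prod_prod, Measure.pi_pi,
    Fin.prod_univ_castSucc]

/-- Two consecutive blocks of an i.i.d. sample are independent. -/
theorem measurePreserving_append {Z : Type*} [MeasurableSpace Z] (P : Measure Z)
    [IsProbabilityMeasure P] (a b : ℕ) :
    MeasurePreserving (fun q : (Fin a → Z) × (Fin b → Z) => Fin.append q.1 q.2)
      ((Measure.pi fun _ : Fin a => P).prod (Measure.pi fun _ : Fin b => P))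
      (Measure.pi fun _ : Fin (a + b) => P) := by
  have hmeas : Measurable fun q : (Fin a → Z) × (Fin b → Z) => Fin.append q.1 q.2 := by
    refine measurable_pi_lambda _ fun i => ?_
    induction i using Fin.addCases <;> simp <;> fun_prop
  refine ⟨hmeas, (Measure.pi_eq fun s hs => ?_).symm⟩
  have hpre : (fun q : (Fin a → Z) × (Fin b → Z) => Fin.append q.1 q.2) ⁻¹' Set.univ.pi s =
      (Set.univ.pi fun i => s (Fin.castAdd b i)) ×ˢ Set.univ.pi fun i => s (Fin.natAdd a i) := by
    ext q
    simp [Set.mem_pi, Fin.forall_fin_add]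
  rw [Measure.map_apply hmeas (.univ_pi hs), hpre, Measure.prod_prod, Measure.pi_pi,
    Measure.pi_pi, Fin.prod_univ_add]

/-- A lower bound that holds for every value of the first block holds for the whole sample. -/
theorem le_pi_of_forall_append {Z : Type*} [MeasurableSpace Z] (P : Measure Z)
    [IsProbabilityMeasure P] (a b : ℕ) {S : Set (Fin (a + b) → Z)} (hS : MeasurableSet S)
    {c : ℝ≥0∞} (h : ∀ w : Fin a → Z,
      c ≤ (Measure.pi fun _ : Fin b => P) {v | Fin.append w v ∈ S}) :
    c ≤ (Measure.pi fun _ : Fin (a + b) => P) S := by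
  have hmp := measurePreserving_append P a b
  rw [← hmp.measure_preimage hS.nullMeasurableSet, Measure.prod_apply (hmp.measurable hS)]
  calc c = ∫⁻ _, c ∂(Measure.pi fun _ : Fin a => P) := by simp
    _ ≤ _ := lintegral_mono h

/-- The `k`-th smallest calibration residual lies below `|m X - f X|` at the test point with
probability at most `2 (N - k) / N`, where `N` counts the calibration and test points. -/
theorem IsCondMedian.mul_pi_le_card_filter_lt {d n : ℕ} {P : Measure ((Fin d → ℝ) × ℝ)}
    [IsProbabilityMeasure P] {m f : (Fin d → ℝ) → ℝ} (hm : IsCondMedian P m) (hf : Measurable f)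
    (k : ℕ) :
    ((n + 1 : ℕ) : ℝ≥0∞) * (Measure.pi fun _ : Fin (n + 1) => P)
        {ω | k ≤ (Finset.univ.filter fun j : Fin n =>
          |(ω j.castSucc).2 - f (ω j.castSucc).1| <
            |m (ω (Fin.last n)).1 - f (ω (Fin.last n)).1|).card}
      ≤ 2 * (n + 1 - k : ℕ) := by
  have hmm := hm.1
  set ν := Measure.pi fun _ : Fin (n + 1) => P
  let E : (Fin d → ℝ) × ℝ → ℝ := fun z => |z.2 - f z.1|
  have hE : Measurable E := by fun_prop
  set T : Set (Fin (n + 1) → (Fin d → ℝ) × ℝ) :=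
    {ω | k ≤ (Finset.univ.filter fun j : Fin n =>
      E (ω j.castSucc) < |m (ω (Fin.last n)).1 - f (ω (Fin.last n)).1|).card}
  have hT : MeasurableSet T :=
    measurableSet_le_card_filter (fun j => measurableSet_lt (by fun_prop) (by fun_prop)) k
  set R : Set (Fin (n + 1) → (Fin d → ℝ) × ℝ) :=
    {ω | |m (ω (Fin.last n)).1 - f (ω (Fin.last n)).1| ≤ E (ω (Fin.last n))}
  have hR : MeasurableSet R := measurableSet_le (by fun_prop) (by fun_prop)
  have hhalf : ν T ≤ 2 * ν (T ∩ R) := by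
    have hmp := measurePreserving_snoc P n
    rw [← hmp.measure_preimage hT.nullMeasurableSet,
      ← hmp.measure_preimage (hT.inter hR).nullMeasurableSet,
      Measure.prod_apply (hmp.measurable hT), Measure.prod_apply (hmp.measurable (hT.inter hR)),
      ← lintegral_const_mul' _ _ (by simp)]
    refine lintegral_mono fun w => ?_
    have hM : MeasurableSet {x : Fin d → ℝ |
        k ≤ (Finset.univ.filter fun j : Fin n => E (w j) < |m x - f x|).card} :=
      measurableSet_le_card_filter (fun j => measurableSet_lt (by fun_prop) (by fun_prop)) k
    convert hm.fst_le_two_mul hf hM using 3 <;> ext z <;> simp [T, R, E]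
  have hsub : T ∩ R ⊆
      {ω | k ≤ (Finset.univ.filter fun j => E (ω j) < E (ω (Fin.last n))).card} := by
    rintro ω ⟨hω, hωR⟩
    refine (Set.mem_ofPred_eq ▸ hω : k ≤ _).trans ?_
    rw [← Finset.card_map Fin.castSuccEmb]
    refine Finset.card_le_card fun j hj => ?_
    obtain ⟨i, hi, rfl⟩ := Finset.mem_map.mp hj
    simp only [Finset.mem_filter_univ] at hi ⊢
    exact lt_of_lt_of_le hi hωR
  calc ((n + 1 : ℕ) : ℝ≥0∞) * ν T ≤ (n + 1 : ℕ) * (2 * ν (T ∩ R)) := by gcongr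
    _ = 2 * ((n + 1 : ℕ) * ν (T ∩ R)) := by ring
    _ ≤ 2 * ((n + 1 : ℕ) * ν
          {ω | k ≤ (Finset.univ.filter fun j => E (ω j) < E (ω (Fin.last n))).card}) := by
        gcongr
    _ ≤ _ := by
        gcongr
        simpa using card_mul_pi_le_card_filter_lt P hE k (Fin.last n)

theorem EReal.sub_le_and_le_add_of_abs_sub_le {a b : ℝ} {Q : EReal} (h : (|b - a| : ℝ) ≤ Q) :
    (a : EReal) - Q ≤ b ∧ (b : EReal) ≤ a + Q := by
  induction Q with
  | bot => simp at h
  | top => simp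
  | coe q =>
    rw [EReal.coe_le_coe_iff, abs_le] at h
    norm_cast
    constructor <;> linarith

/-- Split conformal coverage of the conditional median, for a fixed regression function. -/
theorem IsCondMedian.ofReal_one_sub_le_pi {d n : ℕ} {P : Measure ((Fin d → ℝ) × ℝ)}
    [IsProbabilityMeasure P] {m f : (Fin d → ℝ) → ℝ} (hm : IsCondMedian P m) (hf : Measurable f)
    {α : ℝ} (hα : α ∈ Set.Ioo (0 : ℝ) 1) :
    ENNReal.ofReal (1 - α) ≤ (Measure.pi fun _ : Fin (n + 1) => P)
      {ω | ((|m (ω (Fin.last n)).1 - f (ω (Fin.last n)).1| : ℝ) : EReal) ≤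
        kthSmallest (fun j : Fin n => |(ω j.castSucc).2 - f (ω j.castSucc).1|)
          ⌈(1 - α / 2) * ((n : ℝ) + 1)⌉} := by
  have hmm := hm.1
  set k := ⌈(1 - α / 2) * ((n : ℝ) + 1)⌉
  set ν := Measure.pi fun _ : Fin (n + 1) => P
  set T : Set (Fin (n + 1) → (Fin d → ℝ) × ℝ) :=
    {ω | k.toNat ≤ (Finset.univ.filter fun j : Fin n =>
      |(ω j.castSucc).2 - f (ω j.castSucc).1| <
        |m (ω (Fin.last n)).1 - f (ω (Fin.last n)).1|).card}
  have hT : MeasurableSet T :=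
    measurableSet_le_card_filter (fun j => measurableSet_lt (by fun_prop) (by fun_prop)) _
  have hk_lower : (1 - α / 2) * ((n : ℝ) + 1) ≤ k.toNat := by
    have h1 : (1 - α / 2) * ((n : ℝ) + 1) ≤ k := Int.le_ceil _
    have h2 : (k : ℝ) ≤ (k.toNat : ℝ) := by exact_mod_cast Int.self_le_toNat k
    linarith
  have hbound : ν T ≤ ENNReal.ofReal α := by
    have h := hm.mul_pi_le_card_filter_lt (n := n) hf k.toNat
    have hn : ((n + 1 : ℕ) : ℝ≥0∞) ≠ 0 := by simp
    refine (ENNReal.mul_le_mul_iff_right hn (by finiteness)).mp (h.trans ?_)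
    have hcast : 2 * ((n + 1 - k.toNat : ℕ) : ℝ) ≤ (n + 1 : ℕ) * α := by
      rcases le_total k.toNat (n + 1) with hle | hle
      · push_cast [Nat.cast_sub hle]
        linarith
      · rw [Nat.sub_eq_zero_of_le hle]
        have := hα.1
        push_cast
        nlinarith
    rw [← ENNReal.ofReal_natCast (n + 1), ← ENNReal.ofReal_mul (by positivity)]
    refine le_trans (le_of_eq ?_) (ENNReal.ofReal_le_ofReal hcast)
    rw [ENNReal.ofReal_mul (by norm_num)]
    simp
  calc ENNReal.ofReal (1 - α) = 1 - ENNReal.ofReal α := by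
        rw [ENNReal.ofReal_sub _ hα.1.le, ENNReal.ofReal_one]
    _ ≤ 1 - ν T := tsub_le_tsub_left hbound 1
    _ = ν Tᶜ := (prob_compl_eq_one_sub hT).symm
    _ ≤ _ := measure_mono fun ω hω => not_lt.mp fun hlt =>
        hω (le_card_filter_lt_of_kthSmallest_lt hlt)

/-- **Theorem 2.1** (split conformal coverage of the conditional median). -/
theorem statement_0 {d n₁ n₂ : ℕ} (hd : 1 ≤ d) (hn₁ : 1 ≤ n₁) (hn₂ : 1 ≤ n₂)
    {α : ℝ} (hα : α ∈ Set.Ioo (0 : ℝ) 1)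
    (P : Measure ((Fin d → ℝ) × ℝ)) [IsProbabilityMeasure P]
    (A : (Fin n₁ → ((Fin d → ℝ) × ℝ)) → (Fin d → ℝ) → ℝ)
    (hA : ∀ data, Measurable (A data))
    (m : (Fin d → ℝ) → ℝ) (hm : IsCondMedian P m)
    (hmeas : MeasurableSet (medianCoverageEvent (n₂ := n₂) α A m)) :
    ENNReal.ofReal (1 - α) ≤
      (Measure.pi fun _ : Fin (n₁ + n₂ + 1) => P) (medianCoverageEvent (n₂ := n₂) α A m) := by
  refine le_pi_of_forall_append P n₁ (n₂ + 1) hmeas fun w => ?_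
  refine (hm.ofReal_one_sub_le_pi (n := n₂) (hA w) hα).trans (measure_mono fun v hv => ?_)
  have htrain : (fun i : Fin n₁ => Fin.append w v (Fin.castLE (by omega) i)) = w :=
    funext fun i => Fin.append_left w v i
  have hcal : ∀ j : Fin n₂, Fin.append w v ⟨n₁ + j.1, by omega⟩ = v j.castSucc :=
    fun j => Fin.append_right w v j.castSucc
  have htest : Fin.append w v (Fin.last (n₁ + n₂)) = v (Fin.last n₂) :=
    Fin.append_right w v (Fin.last n₂)
  have := EReal.sub_le_and_le_add_of_abs_sub_le hv
  change _ ∧ _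
  simpa only [htrain, htest, hcal] using this
end

section
/- Fix α ∈ (0,1). For every ε > 0 there exist N ∈ ℕ and δ ∈ (0,1/2) such that the following holds for every even n > N. Let P^δ be the distribution of (X, X·B) where X ~ Uniform[−1/2, 1/2] and B ∈ {0,1} is independent of X with ℙ(B=1) = 1/2 + δ (so the conditional median of Y given X = x equals x). Let (X₁,Y₁),…,(X_{n+1},Y_{n+1}) be i.i.d. with law P^δ, let n₂ = n/2, and let Q be the ⌈(1−α/2)(n₂+1)⌉-th smallest value of the multiset {|Y_i| : n/2 < i ≤ n}. Then ℙ( |X_{n+1}| ≤ Q ) ≤ 1 − α + ε. -/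
open MeasureTheory ProbabilityTheory
open scoped ENNReal NNReal

/-- The Bernoulli-type law of `B ∈ {true, false}` with `ℙ(B = true) = 1/2 + δ`. -/
noncomputable def bernHalfPlus (δ : ℝ) : Measure Bool :=
  ENNReal.ofReal (1 / 2 + δ) • Measure.dirac true + ENNReal.ofReal (1 / 2 - δ) • Measure.dirac false

/-- The distribution `P^δ` of `(X, X·B)` where `X ~ Uniform[-1/2, 1/2]` and, independently,
`B ∈ {0,1}` with `ℙ(B = 1) = 1/2 + δ`. -/
noncomputable def Pdelta (δ : ℝ) : Measure (ℝ × ℝ) :=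
  Measure.map (fun p : ℝ × Bool => (p.1, if p.2 then p.1 else 0))
    ((volume.restrict (Set.Icc (-(1 / 2) : ℝ) (1 / 2))).prod (bernHalfPlus δ))

theorem card_le_lt_of_lt_kthSmallest {N : ℕ} {E : Fin N → ℝ} {k : ℤ} {x : ℝ}
    (h : (x : EReal) < kthSmallest E k) :
    ((Finset.univ.filter fun i => E i ≤ x).card : ℤ) < k := by
  unfold kthSmallest at h
  split_ifs at h with hk hN
  · exact absurd h not_lt_bot
  · refine lt_of_le_of_lt ?_ hN
    exact_mod_cast (Finset.card_le_univ _).trans_eq (Fintype.card_fin N)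
  · push Not at hk hN
    set l := (Multiset.map E Finset.univ.val).sort (· ≤ ·) with hl
    have hlen : l.length = N := by simp [hl]
    have hsort : l.Pairwise (· ≤ ·) := Multiset.pairwise_sort _ _
    obtain ⟨j, rfl⟩ : ∃ j : ℕ, k = j + 1 := ⟨(k - 1).toNat, by omega⟩
    have hj : j < l.length := by omega
    have hx : x < l[j] := by
      have := EReal.coe_lt_coe_iff.1 h
      rwa [show ((j : ℤ) + 1).toNat - 1 = j by omega, List.getD_eq_getElem _ _ hj] at this
    have hcard : (Finset.univ.filter fun i => E i ≤ x).card = l.countP (· ≤ x) := by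
      rw [← Multiset.coe_countP, hl, Multiset.sort_eq, Multiset.countP_map]
      rfl
    have hdrop : (l.drop j).countP (· ≤ x) = 0 := by
      rw [List.countP_eq_zero]
      intro a ha
      obtain ⟨i, hi, rfl⟩ := List.mem_iff_getElem.1 ha
      have : l[j] ≤ (l.drop j)[i] := by
        rw [List.getElem_drop]
        exact hsort.rel_get_of_le (a := ⟨j, hj⟩) (b := ⟨j + i, by simp at hi; omega⟩) (by simp)
      simpa using hx.trans_le this
    have htake : (l.take j).countP (· ≤ x) ≤ j :=
      List.countP_le_length.trans (by simp)
    rw [hcard, ← List.take_append_drop j l, List.countP_append, hdrop]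
    omega

theorem pi_card_mem_le_sub_le {ι κ Ω : Type*} [Fintype ι] [Fintype κ] [MeasurableSpace Ω]
    (μ : Measure Ω) [IsProbabilityMeasure μ] {f : κ → ι} (hf : f.Injective) {S : Set Ω}
    [DecidablePred (· ∈ S)] (hS : MeasurableSet S) {r : ℝ} (hr : 0 < r) :
    (Measure.pi fun _ : ι => μ)
        {ω | ((Finset.univ.filter fun j => ω (f j) ∈ S).card : ℝ) ≤
          Fintype.card κ * μ.real S - r} ≤
      ENNReal.ofReal (Fintype.card κ / (4 * r ^ 2)) := by
  set P := Measure.pi fun _ : ι => μ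
  set X : κ → (ι → Ω) → ℝ := fun j ω => S.indicator 1 (ω (f j)) with hX
  have hind : Measurable (S.indicator (1 : Ω → ℝ)) := measurable_one.indicator hS
  have hmeas (j : κ) : Measurable (X j) := hind.comp (measurable_pi_apply _)
  have hIcc (j : κ) : ∀ ω, X j ω ∈ Set.Icc (0 : ℝ) 1 := fun ω => by
    by_cases h : ω (f j) ∈ S <;> simp [hX, h]
  have hLp (j : κ) : MemLp (X j) 2 P :=
    MemLp.of_bound (hmeas j).aestronglyMeasurable 1 <| ae_of_all _ fun ω => by
      rw [Real.norm_eq_abs, abs_of_nonneg (hIcc j ω).1]; exact (hIcc j ω).2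
  have hmean (j : κ) : P[X j] = μ.real S := by
    rw [← integral_indicator_one hS, ← (measurePreserving_eval (fun _ : ι => μ) (f j)).map_eq,
      integral_map (measurable_pi_apply _).aemeasurable hind.aestronglyMeasurable]
  have hsum : P[∑ j, X j] = Fintype.card κ * μ.real S := by
    simp only [Finset.sum_apply]
    rw [integral_finsetSum _ fun j _ => (hLp j).integrable (by norm_num)]
    simp [hmean]
  have hvar : variance (∑ j, X j) P ≤ Fintype.card κ / 4 := by
    rw [IndepFun.variance_sum (fun j _ => hLp j)]
    · refine (Finset.sum_le_sum fun j _ =>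
        variance_le_sq_of_bounded (ae_of_all _ (hIcc j)) (hmeas j).aemeasurable).trans_eq ?_
      simp only [Finset.sum_const, Finset.card_univ, nsmul_eq_mul]
      ring
    · intro i _ j _ hij
      exact (iIndepFun_pi (μ := fun _ : ι => μ) (X := fun _ => S.indicator (1 : Ω → ℝ))
        fun _ => hind.aemeasurable).indepFun (hf.ne hij)
  have hcard (ω : ι → Ω) :
      (∑ j, X j) ω = ((Finset.univ.filter fun j => ω (f j) ∈ S).card : ℝ) := by
    simp [hX, Set.indicator_apply, Finset.sum_boole]
  calc
    _ ≤ P {ω | r ≤ |(∑ j, X j) ω - P[∑ j, X j]|} := by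
      refine measure_mono fun ω hω => ?_
      simp only [Set.mem_ofPred_eq] at hω ⊢
      rw [hsum, hcard, abs_sub_comm]
      exact le_trans (by linarith) (le_abs_self _)
    _ ≤ ENNReal.ofReal (variance (∑ j, X j) P / r ^ 2) :=
      meas_ge_le_variance_div_sq (memLp_finsetSum' _ fun j _ => hLp j) hr
    _ ≤ _ := by
      refine ENNReal.ofReal_le_ofReal ?_
      rw [← div_div]
      gcongr

theorem Pdelta_apply {δ : ℝ} {S : Set (ℝ × ℝ)} (hS : MeasurableSet S) :
    Pdelta δ S =
      ENNReal.ofReal (1 / 2 + δ) *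
          volume ({x : ℝ | (x, x) ∈ S} ∩ Set.Icc (-(1 / 2)) (1 / 2)) +
        ENNReal.ofReal (1 / 2 - δ) *
          volume ({x : ℝ | (x, (0 : ℝ)) ∈ S} ∩ Set.Icc (-(1 / 2)) (1 / 2)) := by
  have hm : Measurable fun p : ℝ × Bool => (p.1, if p.2 then p.1 else (0 : ℝ)) :=
    measurable_fst.prodMk (Measurable.ite (measurable_snd (measurableSet_singleton true))
      measurable_fst measurable_const)
  have h1 : MeasurableSet {x : ℝ | (x, x) ∈ S} := (measurable_id.prodMk measurable_id) hS
  have h0 : MeasurableSet {x : ℝ | (x, (0 : ℝ)) ∈ S} :=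
    (measurable_id.prodMk measurable_const) hS
  rw [Pdelta, Measure.map_apply hm hS, bernHalfPlus, Measure.prod_apply_symm (hm hS),
    lintegral_add_measure, lintegral_smul_measure, lintegral_smul_measure, lintegral_dirac,
    lintegral_dirac, ← Measure.restrict_apply h1, ← Measure.restrict_apply h0]
  simp [Set.preimage]

theorem isProbabilityMeasure_Pdelta {δ : ℝ} (hδ : δ ∈ Set.Ioo (0 : ℝ) (1 / 2)) :
    IsProbabilityMeasure (Pdelta δ) := by
  refine ⟨?_⟩
  rw [Pdelta_apply MeasurableSet.univ]
  have h : (1 / 2 : ℝ) - -(1 / 2) = 1 := by norm_num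
  simp only [Set.mem_univ, Set.ofPred_true, Set.univ_inter, Real.volume_Icc, h,
    ENNReal.ofReal_one, mul_one]
  rw [← ENNReal.ofReal_add (by linarith [hδ.1]) (by linarith [hδ.2])]
  norm_num

theorem volume_abs_le_inter_Icc {t : ℝ} (ht : t ≤ 1 / 2) :
    volume ({x : ℝ | |x| ≤ t} ∩ Set.Icc (-(1 / 2)) (1 / 2)) = ENNReal.ofReal (2 * t) := by
  have : {x : ℝ | |x| ≤ t} ∩ Set.Icc (-(1 / 2)) (1 / 2) = Set.Icc (-t) t := by
    ext x
    simp only [Set.mem_inter_iff, Set.mem_ofPred_eq, Set.mem_Icc, abs_le]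
    exact ⟨fun h => h.1, fun h => ⟨h, by linarith [h.1], by linarith [h.2]⟩⟩
  rw [this, Real.volume_Icc]
  ring_nf

theorem Pdelta_abs_fst_le {δ t : ℝ} (hδ : δ ∈ Set.Ioo (0 : ℝ) (1 / 2)) (ht : t ≤ 1 / 2) :
    Pdelta δ {z | |z.1| ≤ t} = ENNReal.ofReal (2 * t) := by
  rw [Pdelta_apply (measurableSet_le (by fun_prop) (by fun_prop))]
  simp only [Set.mem_ofPred_eq]
  rw [volume_abs_le_inter_Icc ht, ← add_mul,
    ← ENNReal.ofReal_add (by linarith [hδ.1]) (by linarith [hδ.2])]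
  norm_num

theorem Pdelta_real_abs_snd_le {δ t : ℝ} (hδ : δ ∈ Set.Ioo (0 : ℝ) (1 / 2)) (ht₀ : 0 ≤ t)
    (ht : t ≤ 1 / 2) :
    (Pdelta δ).real {z | |z.2| ≤ t} = (1 / 2 + δ) * (2 * t) + (1 / 2 - δ) := by
  have h : (1 / 2 : ℝ) - -(1 / 2) = 1 := by norm_num
  have h1 : 0 ≤ 1 / 2 + δ := by linarith [hδ.1]
  have h2 : 0 ≤ 1 / 2 - δ := by linarith [hδ.2]
  rw [Measure.real, Pdelta_apply (measurableSet_le (by fun_prop) (by fun_prop))]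
  simp only [Set.mem_ofPred_eq, abs_zero, ht₀, Set.ofPred_true, Set.univ_inter, Real.volume_Icc, h,
    ENNReal.ofReal_one, mul_one]
  rw [volume_abs_le_inter_Icc ht, ← ENNReal.ofReal_mul h1, ← ENNReal.ofReal_add (by positivity) h2,
    ENNReal.toReal_ofReal (by positivity)]

/-- **Theorem 2.3** (sharpness of the `1 - α/2` quantile in Algorithm 1 on `P^δ`).
Datapoints are indexed by `Fin (n + 1)`; with the zero regression function and the split
`n₁ = n₂ = n/2`, the calibration residuals are `|Y_i|` for `n/2 < i ≤ n` and the output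
interval covers the conditional median `m(X_{n+1}) = X_{n+1}` iff `|X_{n+1}| ≤ Q`. -/
theorem statement_2 {α : ℝ} (hα : α ∈ Set.Ioo (0 : ℝ) 1) :
    ∀ ε > (0 : ℝ), ∃ (N : ℕ) (δ : ℝ), δ ∈ Set.Ioo (0 : ℝ) (1 / 2) ∧
      ∀ n : ℕ, N < n → Even n →
        (Measure.pi fun _ : Fin (n + 1) => Pdelta δ)
            {ω | ((|(ω (Fin.last n)).1| : ℝ) : EReal) ≤
              kthSmallest
                (fun j : Fin (n / 2) => |(ω ⟨n / 2 + j.1, by have := j.2; omega⟩).2|)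
                ⌈(1 - α / 2) * ((n / 2 : ℕ) + 1 : ℝ)⌉} ≤
          ENNReal.ofReal (1 - α + ε) := by
  intro ε hε
  obtain ⟨hα₀, hα₁⟩ := hα
  set e := min ε α with he
  have he₀ : 0 < e := lt_min hε hα₀
  have heε : e ≤ ε := min_le_left _ _
  have heα : e ≤ α := min_le_right _ _
  have hδ : e / 8 ∈ Set.Ioo (0 : ℝ) (1 / 2) := ⟨by linarith, by linarith⟩
  refine ⟨2 * ⌈128 / e ^ 3⌉₊, e / 8, hδ, fun n hn _ => ?_⟩
  have := isProbabilityMeasure_Pdelta hδ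
  obtain ⟨t, ht⟩ : ∃ t : ℝ, 2 * t = 1 - α + e / 2 := ⟨(1 - α + e / 2) / 2, by ring⟩
  have ht₀ : 0 ≤ t := by linarith
  have ht₁ : t ≤ 1 / 2 := by linarith
  set m := n / 2 with hm
  set f : Fin m → Fin (n + 1) := fun j => ⟨m + j.1, by have := j.2; omega⟩ with hf
  have hfinj : f.Injective := fun i j hij => by
    simpa [hf, Fin.ext_iff] using hij
  have hmN : (128 : ℝ) / e ^ 3 ≤ m := by
    refine (Nat.le_ceil _).trans ?_
    exact_mod_cast (by omega : ⌈128 / e ^ 3⌉₊ ≤ m)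
  have hm3 : 128 ≤ m * e ^ 3 := (div_le_iff₀ (by positivity)).1 hmN
  have hm₀ : (0 : ℝ) < m := lt_of_lt_of_le (by positivity) hmN
  have hme : 16 ≤ m * e := by
    have : m * e * e ^ 2 ≤ m * e * 1 :=
      mul_le_mul_of_nonneg_left (pow_le_one₀ he₀.le (by linarith)) (by positivity)
    nlinarith
  have hr : 0 < m * e / 16 := by positivity
  set S : Set (ℝ × ℝ) := {z | |z.2| ≤ t} with hSdef
  have hS : MeasurableSet S := measurableSet_le (by fun_prop) (by fun_prop)
  have hp : 1 - α / 2 + e / 8 ≤ (Pdelta (e / 8)).real S := by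
    rw [Pdelta_real_abs_snd_le hδ ht₀ ht₁, ht]
    nlinarith
  classical
  set P := Measure.pi fun _ : Fin (n + 1) => Pdelta (e / 8)
  calc
    _ ≤ P ({ω | |(ω (Fin.last n)).1| ≤ t} ∪
        {ω | ((Finset.univ.filter fun j => ω (f j) ∈ S).card : ℝ) ≤
          Fintype.card (Fin m) * (Pdelta (e / 8)).real S - m * e / 16}) := by
      refine measure_mono fun ω hω => ?_
      by_cases h : |(ω (Fin.last n)).1| ≤ t
      · exact Or.inl h
      right
      have hlt := card_le_lt_of_lt_kthSmallest
        ((EReal.coe_lt_coe_iff.2 (not_le.1 h)).trans_le hω)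
      have hlt' := Int.lt_ceil.1 hlt
      push_cast at hlt'
      simp only [Set.mem_ofPred_eq, Fintype.card_fin]
      have : m * (1 - α / 2 + e / 8) ≤ m * (Pdelta (e / 8)).real S :=
        mul_le_mul_of_nonneg_left hp hm₀.le
      refine hlt'.le.trans ?_
      nlinarith
    _ ≤ ENNReal.ofReal (2 * t) + ENNReal.ofReal (m / (4 * (m * e / 16) ^ 2)) := by
      refine (measure_union_le _ _).trans (add_le_add (le_of_eq ?_) ?_)
      · rw [← Pdelta_abs_fst_le hδ ht₁]
        exact (measurePreserving_eval (fun _ => Pdelta (e / 8)) (Fin.last n)).measure_preimage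
          (s := {z : ℝ × ℝ | |z.1| ≤ t})
          (measurableSet_le (by fun_prop) (by fun_prop)).nullMeasurableSet
      · simpa using pi_card_mem_le_sub_le (Pdelta (e / 8)) hfinj hS hr
    _ ≤ ENNReal.ofReal (1 - α + ε) := by
      rw [← ENNReal.ofReal_add (by linarith) (by positivity), ht]
      refine ENNReal.ofReal_le_ofReal ?_
      have : m / (4 * (m * e / 16) ^ 2) ≤ e / 2 := by
        rw [div_le_iff₀ (by positivity)]
        nlinarith
      linarith
end

section
/- Fix α ∈ (0,1). For every ε > 0 there exist c > 0 and N ∈ ℕ such that for all n > N, setting n₂ = ⌊2/α⌋ + 1 and n₁ = n − n₂, the following holds for every probability distribution P on ℝ^d × ℝ and every conditional median function m of P. Let (X₁,Y₁),…,(X_{n+1},Y_{n+1}) be i.i.d. with law P, let M = max_{1 ≤ i ≤ n₁} |Y_i|, and, conditionally on the data, let (A_i)_{i ∈ {n₁+1,…,n,n+1}} be independent Gaussian random variables each with mean 0 and standard deviation cM. Let Q be the ⌈(1−α/2)(n₂+1)⌉-th smallest value of the multiset {|Y_i − A_i| : n₁ < i ≤ n}. Then Q is finite, and ℙ( A_{n+1}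 − Q ≤ m(X_{n+1}) ≤ A_{n+1} + Q ) ≥ 1 − α/2 − ε. -/
open MeasureTheory ProbabilityTheory
open scoped ENNReal NNReal

/-- Sample space for Theorem 2.4: `n + 1` i.i.d. datapoints together with `n₂ + 1` auxiliary
standard Gaussians (one for each calibration point and one for the test point). -/
abbrev Omega3 (d n n₂ : ℕ) : Type :=
  (Fin (n + 1) → ((Fin d → ℝ) × ℝ)) × (Fin (n₂ + 1) → ℝ)

/-- `M = max_{1 ≤ i ≤ n₁} |Y_i|` over the training set (the first `n₁ = n - n₂` datapoints). -/
noncomputable def Mmax {d : ℕ} (n n₂ : ℕ) (ω : Omega3 d n n₂) : ℝ :=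
  ⨆ i : Fin (n - n₂), |(ω.1 (Fin.castLE (by omega) i)).2|

/-- The randomized prediction `A_i = c · M · Z_i` at the `j`-th calibration point
(`j < n₂`) or at the test point (`j = n₂`). -/
noncomputable def Apred {d : ℕ} (c : ℝ) (n n₂ : ℕ) (ω : Omega3 d n n₂) (j : Fin (n₂ + 1)) : ℝ :=
  c * Mmax n n₂ ω * ω.2 j

/-- The calibration quantile `Q`: the `k`-th smallest value of the residuals
`|Y_i - A_i|` over the `n₂` calibration points. -/
noncomputable def Q3 {d : ℕ} (c : ℝ) (k : ℤ) (n n₂ : ℕ) (ω : Omega3 d n n₂) : EReal :=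
  kthSmallest
    (fun j : Fin n₂ =>
      |(ω.1 ⟨min (n - n₂ + j.1) n, by omega⟩).2 - Apred c n n₂ ω j.castSucc|) k

/-- The event that the interval `[A_{n+1} - Q, A_{n+1} + Q]` covers `m(X_{n+1})`. -/
def Ev3 {d : ℕ} (c : ℝ) (k : ℤ) (n n₂ : ℕ) (m : (Fin d → ℝ) → ℝ) : Set (Omega3 d n n₂) :=
  {ω |
    (Apred c n n₂ ω (Fin.last n₂) : EReal) - Q3 c k n n₂ ω ≤ (m (ω.1 (Fin.last n)).1 : EReal) ∧
      (m (ω.1 (Fin.last n)).1 : EReal) ≤ (Apred c n n₂ ω (Fin.last n₂) : EReal) + Q3 c k n n₂ ω}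

theorem kthSmallest_eq_coe {N : ℕ} (E : Fin N → ℝ) {k : ℤ} (hk0 : 0 < k) (hkN : k ≤ N) :
    ∃ q : ℝ, kthSmallest E k = q ∧
      ∀ r : ℝ, q < r → k.toNat ≤ (Finset.univ.filter fun j => E j < r).card := by
  refine ⟨_, by rw [kthSmallest, if_neg (by omega), if_neg (by omega)], fun r hr => ?_⟩
  set s := (Multiset.map E Finset.univ.val).sort (· ≤ ·) with hs
  have hlen : s.length = N := by simp [hs]
  have hlt : k.toNat - 1 < s.length := by omega
  rw [List.getD_eq_getElem _ _ hlt] at hr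
  have hsorted : s.Pairwise (· ≤ ·) := Multiset.pairwise_sort _ _
  have htake : ∀ x ∈ s.take k.toNat, x < r := by
    intro x hx
    obtain ⟨i, hi, rfl⟩ := List.mem_iff_getElem.1 hx
    rw [List.length_take] at hi
    rw [List.getElem_take]
    refine lt_of_le_of_lt ?_ hr
    rcases (show i ≤ k.toNat - 1 by omega).eq_or_lt with h | h
    · simp [h]
    · exact List.pairwise_iff_getElem.1 hsorted _ _ _ _ h
  have hcount : k.toNat ≤ s.countP (· < r) := by
    calc k.toNat = (s.take k.toNat).countP (· < r) := by
          rw [List.countP_eq_length.2 (by simpa using htake), List.length_take]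
          omega
      _ ≤ _ := (List.take_sublist _ _).countP_le
  have heq : (s : Multiset ℝ).countP (· < r) = (Finset.univ.filter fun j => E j < r).card := by
    rw [hs, Multiset.sort_eq, Multiset.countP_map]
    rfl
  rw [← heq]
  simpa using hcount

/-- An event on an i.i.d. family has the same probability after permuting the family. -/
theorem measure_pi_preimage_perm {ι α : Type*} [Fintype ι] [MeasurableSpace α]
    (μ : Measure α) [SigmaFinite μ] (σ : Equiv.Perm ι) (s : Set (ι → α)) :
    Measure.pi (fun _ : ι => μ) ((fun x => x ∘ σ) ⁻¹' s) = Measure.pi (fun _ : ι => μ) s := by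
  have h := measurePreserving_piCongrLeft (fun _ : ι => μ) σ.symm
  have h2 := h.measure_preimage_equiv s
  rw [← h2]
  congr 2
  funext x i
  simp [MeasurableEquiv.coe_piCongrLeft, Equiv.piCongrLeft, Equiv.piCongrLeft']

theorem sum_measure_le_of_ae_card_le {Ω ι : Type*} [MeasurableSpace Ω] (μ : Measure Ω)
    [IsProbabilityMeasure μ] (S : Finset ι) (B : ι → Set Ω) (hB : ∀ i ∈ S, MeasurableSet (B i))
    [∀ ω, DecidablePred fun i => ω ∈ B i]
    (K : ℕ) (hK : ∀ᵐ ω ∂μ, (S.filter fun i => ω ∈ B i).card ≤ K) :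
    ∑ i ∈ S, μ (B i) ≤ K := by
  calc ∑ i ∈ S, μ (B i) = ∑ i ∈ S, ∫⁻ ω, (B i).indicator 1 ω ∂μ :=
        Finset.sum_congr rfl fun i hi => (lintegral_indicator_one (hB i hi)).symm
    _ = ∫⁻ ω, ∑ i ∈ S, (B i).indicator 1 ω ∂μ :=
        (lintegral_finsetSum' _ fun i hi =>
          (measurable_one.indicator (hB i hi)).aemeasurable).symm
    _ ≤ ∫⁻ _, (K : ℝ≥0∞) ∂μ := by
        refine lintegral_mono_ae (hK.mono fun ω hω => ?_)
        have : ∑ i ∈ S, (B i).indicator (1 : Ω → ℝ≥0∞) ω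
            = ((S.filter fun i => ω ∈ B i).card : ℝ≥0∞) := by
          simp [Set.indicator_apply]
        rw [this]
        exact_mod_cast hω
    _ = K := by simp

/-- A given member of an i.i.d. family is the strict maximum of a subfamily
with probability at most the inverse of the size of the subfamily. -/
theorem card_mul_measure_pi_forall_lt_le {ι α : Type*} [Fintype ι] [DecidableEq ι]
    [MeasurableSpace α] (μ : Measure α) [IsProbabilityMeasure μ] {f : α → ℝ} (hf : Measurable f)
    (S : Finset ι) {j : ι} (hj : j ∉ S) :
    ((S.card : ℝ≥0∞) + 1) * Measure.pi (fun _ : ι => μ) {x | ∀ i ∈ S, f (x i) < f (x j)} ≤ 1 := by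
  classical
  set T := insert j S with hT
  let B : ι → Set (ι → α) := fun a => {x | ∀ i ∈ T, i ≠ a → f (x i) < f (x a)}
  have hB : ∀ a ∈ T, MeasurableSet (B a) := fun a _ => by
    have : B a = ⋂ i ∈ T, ⋂ _ : i ≠ a, {x | f (x i) < f (x a)} := by
      ext x; simp [B]
    rw [this]
    refine Finset.measurableSet_biInter _ fun i _ => MeasurableSet.iInter fun _ => ?_
    exact measurableSet_lt (hf.comp (measurable_pi_apply i)) (hf.comp (measurable_pi_apply a))
  have hBj : B j = {x | ∀ i ∈ S, f (x i) < f (x j)} := by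
    ext x
    simp only [B, hT, Set.mem_ofPred_eq, Finset.mem_insert]
    constructor
    · exact fun h i hi => h i (Or.inr hi) (fun e => hj (e ▸ hi))
    · rintro h i (rfl | hi) hne
      · exact absurd rfl hne
      · exact h i hi
  have hsame : ∀ a ∈ T, Measure.pi (fun _ : ι => μ) (B a) = Measure.pi (fun _ : ι => μ) (B j) := by
    intro a ha
    rw [← measure_pi_preimage_perm μ (Equiv.swap a j) (B j)]
    congr 1
    have hjT : j ∈ T := Finset.mem_insert_self _ _
    have hmem : ∀ i ∈ T, Equiv.swap a j i ∈ T := by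
      intro i hi
      rw [Equiv.swap_apply_def]
      split_ifs <;> assumption
    ext x
    simp only [B, Set.mem_ofPred_eq, Set.mem_preimage, Function.comp, Equiv.swap_apply_right]
    constructor
    · intro h i hi hne
      refine h _ (hmem i hi) fun e => hne ?_
      simpa using congrArg (Equiv.swap a j) e
    · intro h i hi hne
      have := h _ (hmem i hi) fun e => hne ?_
      · simpa using this
      · simpa using congrArg (Equiv.swap a j) e
  have hsum := sum_measure_le_of_ae_card_le (Measure.pi fun _ : ι => μ) T B hB 1 <| by
    refine Filter.Eventually.of_forall fun x => ?_
    rw [Finset.card_le_one]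
    intro a ha b hb
    simp only [Finset.mem_filter] at ha hb
    by_contra hne
    exact lt_asymm (ha.2 b hb.1 (Ne.symm hne)) (hb.2 a ha.1 hne)
  rw [Finset.sum_congr rfl hsame, Finset.sum_const, hT, Finset.card_insert_of_notMem hj, hBj] at hsum
  simpa using hsum

theorem card_filter_le_rank_of_injective {ι : Type*} [Fintype ι] [DecidableEq ι] {g : ι → ℝ}
    (hg : Function.Injective g) (k : ℕ) :
    (Finset.univ.filter fun i =>
      k ≤ (Finset.univ.filter fun j => j ≠ i ∧ g j ≤ g i).card).card ≤ Fintype.card ι - k := by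
  have hr : ∀ i, (Finset.univ.filter fun j => j ≠ i ∧ g j ≤ g i)
      = Finset.univ.filter fun j => g j < g i := by
    intro i
    ext j
    simp only [Finset.mem_filter, Finset.mem_univ, true_and]
    exact ⟨fun h => lt_of_le_of_ne h.2 (hg.ne h.1), fun h => ⟨fun e => by simp [e] at h, h.le⟩⟩
  simp only [hr]
  have hmono : ∀ a b, g a < g b → (Finset.univ.filter fun j => g j < g a).card
      < (Finset.univ.filter fun j => g j < g b).card := by
    intro a b hab
    refine Finset.card_lt_card ⟨fun j hj => ?_, fun h => ?_⟩
    · simp only [Finset.mem_filter, Finset.mem_univ, true_and] at hj ⊢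
      exact hj.trans hab
    · simpa using h (show a ∈ _ by simpa using hab)
  rw [← Nat.card_Ico]
  refine Finset.card_le_card_of_injOn (fun i => (Finset.univ.filter fun j => g j < g i).card)
    (fun i hi => ?_) (fun a _ b _ hab => ?_)
  · simp only [Finset.coe_filter, Finset.mem_univ, true_and, Set.mem_ofPred_eq] at hi
    simp only [Finset.coe_Ico, Set.mem_Ico]
    exact ⟨hi, Finset.card_lt_univ_of_notMem (x := i) (by simp)⟩
  · by_contra hne
    rcases lt_or_gt_of_ne (hg.ne hne) with h | h
    · exact (hmono _ _ h).ne hab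
    · exact (hmono _ _ h).ne' hab

theorem ae_pi_injective {ι α : Type*} [Fintype ι] [MeasurableSpace α] (μ : Measure α)
    [IsProbabilityMeasure μ] {f : α → ℝ} (hf : Measurable f) (h0 : ∀ t, μ {x | f x = t} = 0) :
    ∀ᵐ x ∂(Measure.pi fun _ : ι => μ), Function.Injective fun i => f (x i) := by
  have key : ∀ i j : ι, i ≠ j →
      ∀ᵐ x ∂(Measure.pi fun _ : ι => μ), f (x i) ≠ f (x j) := by
    intro i j hij
    have hind : iIndepFun (fun i (ω : ι → α) => ω i) (Measure.pi fun _ : ι => μ) :=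
      iIndepFun_pi (X := fun _ => id) fun _ => aemeasurable_id
    have hmap := (hind.indepFun hij).map_prod_eq_prod_map_map
      (measurable_pi_apply i).aemeasurable (measurable_pi_apply j).aemeasurable
    rw [(measurePreserving_eval (fun _ : ι => μ) i).map_eq,
      (measurePreserving_eval (fun _ : ι => μ) j).map_eq] at hmap
    have hms : MeasurableSet {p : α × α | f p.1 = f p.2} :=
      measurableSet_eq_fun (hf.comp measurable_fst) (hf.comp measurable_snd)
    have hz : (μ.prod μ) {p : α × α | f p.1 = f p.2} = 0 := by
      rw [Measure.measure_prod_null hms]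
      refine Filter.Eventually.of_forall fun a => ?_
      have : Prod.mk a ⁻¹' {p : α × α | f p.1 = f p.2} = {y | f y = f a} := by
        ext y; simp [eq_comm]
      simpa [this] using h0 (f a)
    rw [← hmap, Measure.map_apply ((measurable_pi_apply i).prodMk (measurable_pi_apply j)) hms] at hz
    rw [ae_iff]
    simpa using hz
  have hall : ∀ᵐ x ∂(Measure.pi fun _ : ι => μ), ∀ i j : ι, i ≠ j → f (x i) ≠ f (x j) := by
    rw [ae_all_iff]; intro i
    rw [ae_all_iff]; intro j
    by_cases hij : i = j
    · simp [hij]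
    · simpa [hij] using key i j hij
  filter_upwards [hall] with x hx i j hij
  by_contra hne
  exact hx i j hne hij

theorem measurableSet_le_card_filter_le_add {ι α : Type*} [Fintype ι] [DecidableEq ι]
    [MeasurableSpace α] {f : α → ℝ} (hf : Measurable f) (k : ℕ) (i : ι) :
    MeasurableSet {x : ι → α |
      k ≤ (Finset.univ.filter fun j => j ≠ i ∧ f (x j) ≤ f (x i)).card} := by
  simp only [Finset.card_filter]
  refine measurableSet_le measurable_const (Finset.measurable_fun_sum _ fun j _ => ?_)
  refine Measurable.ite ?_ measurable_const measurable_const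
  exact (MeasurableSet.const _).inter
    (measurableSet_le (hf.comp (measurable_pi_apply j)) (hf.comp (measurable_pi_apply i)))

/-- For an i.i.d. family without ties, at least `k` of the other members lie below a given one
with probability at most `(card ι - k) / card ι`. -/
theorem card_mul_measure_pi_rank_le {ι α : Type*} [Fintype ι] [DecidableEq ι]
    [MeasurableSpace α] (μ : Measure α) [IsProbabilityMeasure μ] {f : α → ℝ} (hf : Measurable f)
    (h0 : ∀ t, μ {x | f x = t} = 0) (k : ℕ) (i₀ : ι) :
    (Fintype.card ι : ℝ≥0∞) * Measure.pi (fun _ : ι => μ)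
      {x | k ≤ (Finset.univ.filter fun j => j ≠ i₀ ∧ f (x j) ≤ f (x i₀)).card}
      ≤ (Fintype.card ι - k : ℕ) := by
  classical
  let B : ι → Set (ι → α) := fun i =>
    {x | k ≤ (Finset.univ.filter fun j => j ≠ i ∧ f (x j) ≤ f (x i)).card}
  have hsame : ∀ a ∈ Finset.univ,
      Measure.pi (fun _ : ι => μ) (B a) = Measure.pi (fun _ : ι => μ) (B i₀) := by
    intro a _
    rw [← measure_pi_preimage_perm μ (Equiv.swap a i₀) (B i₀)]
    congr 1
    ext x
    simp only [B, Set.mem_ofPred_eq, Set.mem_preimage, Function.comp, Equiv.swap_apply_right]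
    have : (Finset.univ.filter fun j => j ≠ a ∧ f (x j) ≤ f (x a)).card
        = (Finset.univ.filter fun j => j ≠ i₀ ∧ f (x (Equiv.swap a i₀ j)) ≤ f (x a)).card := by
      refine Finset.card_equiv (Equiv.swap a i₀) fun j => ?_
      simp [Equiv.swap_apply_eq_iff]
    rw [this]
  have hsum := sum_measure_le_of_ae_card_le (Measure.pi fun _ : ι => μ) Finset.univ B
    (fun i _ => measurableSet_le_card_filter_le_add hf k i) (Fintype.card ι - k) <| by
      filter_upwards [ae_pi_injective μ hf h0] with x hx
      exact card_filter_le_rank_of_injective hx k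
  rw [Finset.sum_congr rfl hsame, Finset.sum_const] at hsum
  simpa [B] using hsum

/-- A strict bound on the probability of a rank event survives a small enough positive slack
in the comparisons. -/
theorem exists_pos_measure_pi_rank_add_lt {ι α : Type*} [Fintype ι] [DecidableEq ι]
    [MeasurableSpace α] (μ : Measure α) [IsProbabilityMeasure μ] {f : α → ℝ} (hf : Measurable f)
    (k : ℕ) (i₀ : ι) {b : ℝ≥0∞}
    (hb : Measure.pi (fun _ : ι => μ)
      {x | k ≤ (Finset.univ.filter fun j => j ≠ i₀ ∧ f (x j) ≤ f (x i₀)).card} < b) :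
    ∃ δ : ℝ, 0 < δ ∧ Measure.pi (fun _ : ι => μ)
      {x | k ≤ (Finset.univ.filter fun j => j ≠ i₀ ∧ f (x j) ≤ f (x i₀) + δ).card} < b := by
  let δ : ℕ → ℝ := fun p => 1 / ((p : ℝ) + 1)
  have hδ : ∀ p, 0 < δ p := fun p => Nat.one_div_pos_of_nat
  have hδlim : Filter.Tendsto δ Filter.atTop (nhds 0) := tendsto_one_div_add_atTop_nhds_zero_nat
  have hδanti : Antitone δ := fun p q hpq => Nat.one_div_le_one_div hpq
  let s : ℕ → Set (ι → α) := fun p =>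
    {x | k ≤ (Finset.univ.filter fun j => j ≠ i₀ ∧ f (x j) ≤ f (x i₀) + δ p).card}
  have hs : ∀ p, MeasurableSet (s p) := fun p => by
    simp only [s, Finset.card_filter]
    refine measurableSet_le measurable_const (Finset.measurable_fun_sum _ fun j _ => ?_)
    refine Measurable.ite ?_ measurable_const measurable_const
    exact (MeasurableSet.const _).inter (measurableSet_le (hf.comp (measurable_pi_apply j))
      ((hf.comp (measurable_pi_apply i₀)).add_const _))
  have hanti : Antitone s := fun p q hpq x hx => by
    refine le_trans (show k ≤ _ from hx) (Finset.card_le_card fun j => ?_)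
    simp only [Finset.mem_filter, Finset.mem_univ, true_and]
    exact fun h => ⟨h.1, h.2.trans (by linarith [hδanti hpq])⟩
  have hinter : ⋂ p, s p ⊆
      {x | k ≤ (Finset.univ.filter fun j => j ≠ i₀ ∧ f (x j) ≤ f (x i₀)).card} := by
    intro x hx
    have hev : ∀ᶠ p in Filter.atTop, ∀ j : ι, f (x j) ≤ f (x i₀) + δ p → f (x j) ≤ f (x i₀) := by
      rw [Filter.eventually_all]
      intro j
      by_cases h : f (x j) ≤ f (x i₀)
      · exact Filter.Eventually.of_forall fun _ _ => h
      · have : 0 < f (x j) - f (x i₀) := by linarith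
        filter_upwards [hδlim.eventually_lt_const this] with p hp h'
        linarith
    obtain ⟨p, hp⟩ := hev.exists
    refine le_trans (show k ≤ _ from Set.mem_iInter.1 hx p) (Finset.card_le_card fun j => ?_)
    simp only [Finset.mem_filter, Finset.mem_univ, true_and]
    exact fun h => ⟨h.1, hp j h.2⟩
  have hlim := tendsto_measure_iInter_atTop (μ := Measure.pi fun _ : ι => μ)
    (fun p => (hs p).nullMeasurableSet) hanti ⟨0, measure_ne_top _ _⟩
  obtain ⟨p, hp⟩ := (hlim.eventually_lt_const ((measure_mono hinter).trans_lt hb)).exists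
  exact ⟨δ p, hδ p, hp⟩

/-- The conditional median exceeds a threshold in absolute value with at most twice the
probability that the response does. -/
theorem IsCondMedian.measure_lt_abs_le {d : ℕ} {P : Measure ((Fin d → ℝ) × ℝ)}
    [IsProbabilityMeasure P] {m : (Fin d → ℝ) → ℝ} (hm : IsCondMedian P m) (t : ℝ) :
    P {p | t < |m p.1|} ≤ 2 * P {p | t < |p.2|} := by
  have hA : MeasurableSet {x | t < |m x|} :=
    measurableSet_lt measurable_const (measurable_abs.comp hm.1)
  have hY : MeasurableSet {p : (Fin d → ℝ) × ℝ | t < |p.2|} :=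
    measurableSet_lt measurable_const (measurable_abs.comp measurable_snd)
  have h1 : P {p | t < |m p.1|} = P.fst {x | t < |m x|} := by
    rw [Measure.fst_apply hA]; rfl
  have h2 : P {p | t < |p.2|} = ∫⁻ x, P.condKernel x {y | t < |y|} ∂P.fst := by
    conv_lhs => rw [← P.disintegrate P.condKernel]
    rw [Measure.compProd_apply hY]
    rfl
  have h3 : (1 / 2 : ℝ≥0∞) * P.fst {x | t < |m x|} ≤
      ∫⁻ x, P.condKernel x {y | t < |y|} ∂P.fst := by
    rw [← lintegral_indicator_const hA]
    refine lintegral_mono_ae ?_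
    filter_upwards [hm.2] with x hx
    rw [Set.indicator_apply]
    split_ifs with hxt
    · have hxt : t < |m x| := hxt
      rcases le_or_gt 0 (m x) with h | h
      · refine hx.2.trans (measure_mono fun y hy => ?_)
        rw [abs_of_nonneg h] at hxt
        exact hxt.trans_le (le_trans (Set.mem_Ici.1 hy) (le_abs_self y))
      · refine hx.1.trans (measure_mono fun y hy => ?_)
        rw [abs_of_neg h] at hxt
        exact hxt.trans_le (le_trans (neg_le_neg (Set.mem_Iic.1 hy)) (neg_le_abs y))
    · exact zero_le
  rw [h1, h2]
  calc P.fst {x | t < |m x|} = 2 * ((1 / 2 : ℝ≥0∞) * P.fst {x | t < |m x|}) := by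
        rw [← mul_assoc, one_div, ENNReal.mul_inv_cancel two_ne_zero ENNReal.ofNat_ne_top, one_mul]
    _ ≤ _ := by gcongr

theorem measure_lt_le_mul_of_indepFun {Ω β : Type*} [MeasurableSpace Ω] [MeasurableSpace β]
    {μ : Measure Ω} [IsProbabilityMeasure μ] {U : Ω → β} {T : Ω → ℝ} (hU : Measurable U)
    (hT : Measurable T) (hind : IndepFun U T μ) {h g : β → ℝ} (hh : Measurable h)
    (hg : Measurable g) {K : ℝ≥0∞}
    (hK : ∀ t, μ.map U {u | t < h u} ≤ K * μ.map U {u | t < g u}) :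
    μ {ω | T ω < h (U ω)} ≤ K * μ {ω | T ω < g (U ω)} := by
  have : IsProbabilityMeasure (μ.map U) := Measure.isProbabilityMeasure_map hU.aemeasurable
  have : IsProbabilityMeasure (μ.map T) := Measure.isProbabilityMeasure_map hT.aemeasurable
  have key : ∀ {r : β → ℝ}, Measurable r →
      MeasurableSet {p : β × ℝ | p.2 < r p.1} ∧
      μ {ω | T ω < r (U ω)} = ∫⁻ t, μ.map U {u | t < r u} ∂(μ.map T) := by
    intro r hr
    have hs : MeasurableSet {p : β × ℝ | p.2 < r p.1} :=
      measurableSet_lt measurable_snd (hr.comp measurable_fst)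
    refine ⟨hs, ?_⟩
    calc μ {ω | T ω < r (U ω)} = μ.map (fun ω => (U ω, T ω)) {p : β × ℝ | p.2 < r p.1} := by
          rw [Measure.map_apply (hU.prodMk hT) hs]; rfl
      _ = _ := by
          rw [hind.map_prod_eq_prod_map_map hU.aemeasurable hT.aemeasurable,
            Measure.prod_apply_symm hs]
          rfl
  rw [(key hh).2, (key hg).2, ← lintegral_const_mul]
  · exact lintegral_mono hK
  · exact measurable_measure_prodMk_right (key hg).1

theorem abs_le_Mmax {d n n₂ : ℕ} (ω : Omega3 d n n₂) (i : Fin (n - n₂)) :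
    |(ω.1 (Fin.castLE (by omega) i)).2| ≤ Mmax n n₂ ω :=
  le_ciSup (f := fun i : Fin (n - n₂) => |(ω.1 (Fin.castLE (by omega) i)).2|)
    (Set.finite_range _).bddAbove i

theorem Mmax_nonneg {d n n₂ : ℕ} (ω : Omega3 d n n₂) : 0 ≤ Mmax n n₂ ω :=
  Real.iSup_nonneg fun _ => abs_nonneg _

/-- A later response exceeds the training maximum with probability at most `1 / (n₁ + 1)`. -/
theorem measure_Mmax_lt_abs_le {d n n₂ : ℕ} (P : Measure ((Fin d → ℝ) × ℝ))
    [IsProbabilityMeasure P] (z : Fin (n₂ + 1) → ℝ) (j : Fin (n + 1)) (hj : n - n₂ ≤ j) :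
    (((n - n₂ : ℕ) : ℝ≥0∞) + 1) *
      Measure.pi (fun _ : Fin (n + 1) => P) {x | Mmax n n₂ (x, z) < |(x j).2|} ≤ 1 := by
  let S : Finset (Fin (n + 1)) :=
    Finset.univ.map (Fin.castLEEmb (show n - n₂ ≤ n + 1 by omega))
  have hcard : S.card = n - n₂ := by simp [S]
  have hjS : j ∉ S := by
    simp only [S, Finset.mem_map, not_exists]
    rintro i ⟨-, h⟩
    have := congrArg Fin.val h
    simp at this
    omega
  have h := card_mul_measure_pi_forall_lt_le P (f := fun p => |p.2|)
    (measurable_abs.comp measurable_snd) S hjS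
  rw [hcard] at h
  refine le_trans ?_ h
  gcongr with x
  intro hx i hi
  obtain ⟨i, -, rfl⟩ := Finset.mem_map.1 hi
  exact (abs_le_Mmax (x, z) i).trans_lt hx

theorem measure_Mmax_lt_abs_condMedian_le {d n n₂ : ℕ} (hn : 0 < n₂) (hn2 : n₂ ≤ n)
    {P : Measure ((Fin d → ℝ) × ℝ)} [IsProbabilityMeasure P] {m : (Fin d → ℝ) → ℝ}
    (hm : IsCondMedian P m) (z : Fin (n₂ + 1) → ℝ) :
    Measure.pi (fun _ : Fin (n + 1) => P) {x | Mmax n n₂ (x, z) < |m (x (Fin.last n)).1|} ≤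
      2 * Measure.pi (fun _ : Fin (n + 1) => P)
        {x | Mmax n n₂ (x, z) < |(x (Fin.last n)).2|} := by
  have hlaw := (measurePreserving_eval (fun _ : Fin (n + 1) => P) (Fin.last n)).map_eq
  refine measure_lt_le_mul_of_indepFun (U := fun x : Fin (n + 1) → _ => x (Fin.last n))
    (T := fun x => Mmax n n₂ (x, z)) (measurable_pi_apply _) ?_ ?_
    (h := fun p => |m p.1|) (g := fun p => |p.2|)
    (measurable_abs.comp (hm.1.comp measurable_fst)) (measurable_abs.comp measurable_snd) ?_
  · exact Measurable.iSup fun i => measurable_abs.comp (measurable_snd.comp (measurable_pi_apply _))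
  · have hind : iIndepFun (fun i (x : Fin (n + 1) → (Fin d → ℝ) × ℝ) => x i)
        (Measure.pi fun _ : Fin (n + 1) => P) :=
      iIndepFun_pi (X := fun _ => id) fun _ => aemeasurable_id
    let S : Finset (Fin (n + 1)) :=
      Finset.univ.map (Fin.castLEEmb (show n - n₂ ≤ n + 1 by omega))
    have hdisj : Disjoint {Fin.last n} S := by
      rw [Finset.disjoint_singleton_left]
      simp only [S, Finset.mem_map, not_exists]
      rintro i ⟨-, h⟩
      have := congrArg Fin.val h
      simp at this
      omega
    have hpair := hind.indepFun_finset _ _ hdisj fun i => measurable_pi_apply i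
    let φ : (({Fin.last n} : Finset (Fin (n + 1))) → (Fin d → ℝ) × ℝ) → (Fin d → ℝ) × ℝ :=
      fun y => y ⟨Fin.last n, Finset.mem_singleton_self _⟩
    let ψ : (S → (Fin d → ℝ) × ℝ) → ℝ := fun y =>
      ⨆ i : Fin (n - n₂), |(y ⟨Fin.castLE (by omega) i,
        Finset.mem_map_of_mem _ (Finset.mem_univ i)⟩).2|
    exact hpair.comp (φ := φ) (ψ := ψ) (measurable_pi_apply _) <| Measurable.iSup fun i =>
      measurable_abs.comp (measurable_snd.comp (measurable_pi_apply _))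
  · intro t
    rw [hlaw]
    exact hm.measure_lt_abs_le t

theorem Q3_eq_coe {d : ℕ} (c : ℝ) {k : ℤ} {n n₂ : ℕ} (hk0 : 0 < k) (hk : k ≤ n₂)
    (ω : Omega3 d n n₂) :
    ∃ q : ℝ, Q3 c k n n₂ ω = q ∧ ∀ r : ℝ, q < r →
      k.toNat ≤ (Finset.univ.filter fun j : Fin n₂ =>
        |(ω.1 ⟨min (n - n₂ + j.1) n, by omega⟩).2 - Apred c n n₂ ω j.castSucc| < r).card :=
  kthSmallest_eq_coe _ hk0 hk

/-- If the training maximum dominates the median at the test point and all calibration responses,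
then coverage can only fail when at least `k` of the calibration Gaussians are, up to `2 / c`,
below the test Gaussian in absolute value. -/
theorem mem_Ev3_of_not_le_card {d : ℕ} {c : ℝ} (hc : 0 < c) {k : ℤ} {n n₂ : ℕ} (hk0 : 0 < k)
    (hk : k ≤ n₂) {m : (Fin d → ℝ) → ℝ} {ω : Omega3 d n n₂}
    (hm : |m (ω.1 (Fin.last n)).1| ≤ Mmax n n₂ ω)
    (hY : ∀ j : Fin n₂, |(ω.1 ⟨min (n - n₂ + j.1) n, by omega⟩).2| ≤ Mmax n n₂ ω)
    (hZ : ¬ k.toNat ≤ (Finset.univ.filter fun j : Fin (n₂ + 1) =>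
      j ≠ Fin.last n₂ ∧ |ω.2 j| ≤ |ω.2 (Fin.last n₂)| + 2 / c).card) :
    ω ∈ Ev3 c k n n₂ m := by
  obtain ⟨q, hq, hcount⟩ := Q3_eq_coe c hk0 hk ω
  set A := Apred c n n₂ ω (Fin.last n₂) with hA
  set y := m (ω.1 (Fin.last n)).1 with hy
  suffices h : |y - A| ≤ q by
    rw [abs_le] at h
    change (A : EReal) - _ ≤ (y : EReal) ∧ (y : EReal) ≤ A + _
    rw [hq, ← EReal.coe_sub, ← EReal.coe_add, EReal.coe_le_coe_iff, EReal.coe_le_coe_iff]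
    constructor <;> linarith [h.1, h.2]
  by_contra! hlt
  refine hZ ((hcount _ hlt).trans ?_)
  rw [← Finset.card_map Fin.castSuccEmb]
  refine Finset.card_le_card fun _ hmem => ?_
  obtain ⟨j, hj, rfl⟩ := Finset.mem_map.1 hmem
  clear hmem
  simp only [Finset.mem_filter, Finset.mem_univ, true_and, Fin.coe_castSuccEmb] at hj ⊢
  refine ⟨(Fin.castSucc_lt_last j).ne, ?_⟩
  have hYj := hY j
  set w := (ω.1 ⟨min (n - n₂ + j.1) n, by omega⟩).2
  have hM := Mmax_nonneg ω
  have hAj : Apred c n n₂ ω j.castSucc = c * Mmax n n₂ ω * ω.2 j.castSucc := rfl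
  have hAl : A = c * Mmax n n₂ ω * ω.2 (Fin.last n₂) := rfl
  rcases hM.eq_or_lt with h0 | hpos
  · rw [← h0] at hYj hm hAj hAl
    rw [hAj, hAl, abs_nonpos_iff.1 hYj, abs_nonpos_iff.1 hm] at hj
    simp at hj
  · have hcM : 0 < c * Mmax n n₂ ω := mul_pos hc hpos
    have e1 : |Apred c n n₂ ω j.castSucc| = c * Mmax n n₂ ω * |ω.2 j.castSucc| := by
      rw [hAj, abs_mul, abs_of_pos hcM]
    have e2 : |A| = c * Mmax n n₂ ω * |ω.2 (Fin.last n₂)| := by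
      rw [hAl, abs_mul, abs_of_pos hcM]
    have t1 := abs_sub_abs_le_abs_sub (Apred c n n₂ ω j.castSucc) w
    rw [abs_sub_comm] at t1
    have t2 := abs_sub y A
    have : c * Mmax n n₂ ω * |ω.2 j.castSucc| ≤
        c * Mmax n n₂ ω * (|ω.2 (Fin.last n₂)| + 2 / c) := by
      have e3 : c * Mmax n n₂ ω * (2 / c) = 2 * Mmax n n₂ ω := by field_simp
      rw [mul_add, e3]
      linarith
    exact le_of_mul_le_mul_left this hcM

theorem gaussianReal_abs_eq_null (t : ℝ) : gaussianReal 0 1 {x | |x| = t} = 0 := by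
  have := nullSingletonClass_gaussianReal (μ := 0) (v := 1) one_ne_zero
  refine Set.Finite.measure_zero (Set.Finite.subset (Set.toFinite {t, -t}) fun x hx => ?_) _
  have hx : |x| = t := hx
  rcases abs_choice x with h | h
  · left; rw [← hx, h]
  · right; simp [← hx, h]

/-- **Theorem 2.4** (the randomized Gaussian regression function `μ̂_c` yields a finite
interval with coverage at least `1 - α/2 - ε` for every distribution).  Here
`n₂ = ⌊2/α⌋ + 1`, `n₁ = n - n₂`, and `k = ⌈(1 - α/2)(n₂ + 1)⌉`. -/
theorem statement_3 {d : ℕ} (hd : 1 ≤ d) {α : ℝ} (hα : α ∈ Set.Ioo (0 : ℝ) 1)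
    (ε : ℝ) (hε : 0 < ε) :
    ∃ c > (0 : ℝ), ∃ N : ℕ, ∀ n : ℕ, N < n →
      ∀ (P : Measure ((Fin d → ℝ) × ℝ)) [IsProbabilityMeasure P],
        ∀ m : (Fin d → ℝ) → ℝ, IsCondMedian P m →
          (∀ ω : Omega3 d n (⌊2 / α⌋₊ + 1),
              Q3 c ⌈(1 - α / 2) * (((⌊2 / α⌋₊ + 1 : ℕ) : ℝ) + 1)⌉ n (⌊2 / α⌋₊ + 1) ω ≠ ⊤ ∧
              Q3 c ⌈(1 - α / 2) * (((⌊2 / α⌋₊ + 1 : ℕ) : ℝ) + 1)⌉ n (⌊2 / α⌋₊ + 1) ω ≠ ⊥) ∧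
            ENNReal.ofReal (1 - α / 2 - ε) ≤
              ((Measure.pi fun _ : Fin (n + 1) => P).prod
                  (Measure.pi fun _ : Fin (⌊2 / α⌋₊ + 1 + 1) => gaussianReal 0 1))
                (Ev3 c ⌈(1 - α / 2) * (((⌊2 / α⌋₊ + 1 : ℕ) : ℝ) + 1)⌉ n (⌊2 / α⌋₊ + 1) m) := by
  obtain ⟨hα0, hα1⟩ := hα
  set n₂ : ℕ := ⌊2 / α⌋₊ + 1 with hn₂
  set k : ℤ := ⌈(1 - α / 2) * ((n₂ : ℝ) + 1)⌉ with hk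
  have hn₂α : 2 / α < n₂ := by
    rw [hn₂]; push_cast; exact Nat.lt_floor_add_one _
  have hk0 : 0 < k := Int.ceil_pos.2 (mul_pos (by linarith) (by positivity))
  have hkn : k ≤ n₂ := by
    refine Int.ceil_le.2 ?_
    rw [div_lt_iff₀ hα0] at hn₂α
    push_cast
    nlinarith
  have hkcast : ((k.toNat : ℕ) : ℝ) = k := by
    exact_mod_cast congrArg (Int.cast : ℤ → ℝ) (Int.toNat_of_nonneg hk0.le)
  have hrank : Measure.pi (fun _ : Fin (n₂ + 1) => gaussianReal 0 1)
      {z | k.toNat ≤ (Finset.univ.filter fun j =>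
        j ≠ Fin.last n₂ ∧ |z j| ≤ |z (Fin.last n₂)|).card} < ENNReal.ofReal (α / 2 + ε / 2) := by
    have h := card_mul_measure_pi_rank_le (gaussianReal 0 1) measurable_abs
      gaussianReal_abs_eq_null k.toNat (Fin.last n₂)
    rw [Fintype.card_fin, mul_comm,
      ← ENNReal.le_div_iff_mul_le (Or.inl (by simp)) (Or.inl (by simp))] at h
    refine h.trans_lt ?_
    rw [← ENNReal.ofReal_natCast, ← ENNReal.ofReal_natCast,
      ← ENNReal.ofReal_div_of_pos (by positivity), ENNReal.ofReal_lt_ofReal_iff (by positivity),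
      div_lt_iff₀ (by positivity), Nat.cast_sub (by omega), hkcast]
    have hle : (1 - α / 2) * ((n₂ : ℝ) + 1) ≤ k := Int.le_ceil _
    push_cast
    nlinarith [mul_pos hε (show (0 : ℝ) < (n₂ : ℝ) + 1 by positivity)]
  obtain ⟨δ, hδ, hrankδ⟩ := exists_pos_measure_pi_rank_add_lt _ measurable_abs _ _ hrank
  set η : ℝ := ε / (2 * (n₂ + 2)) with hη
  have hη0 : 0 < η := by positivity
  refine ⟨2 / δ, by positivity, n₂ + ⌈1 / η⌉₊, fun n hn P _ m hm => ⟨fun ω => ?_, ?_⟩⟩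
  · obtain ⟨q, hq, -⟩ := Q3_eq_coe (2 / δ) hk0 hkn ω
    rw [hq]
    exact ⟨EReal.coe_ne_top q, EReal.coe_ne_bot q⟩
  set μ := Measure.pi fun _ : Fin (n + 1) => P
  set ν := Measure.pi fun _ : Fin (n₂ + 1) => gaussianReal 0 1
  have hinv : (((n - n₂ : ℕ) : ℝ≥0∞) + 1)⁻¹ ≤ ENNReal.ofReal η := by
    have hle : 1 / η ≤ ((n - n₂ + 1 : ℕ) : ℝ) :=
      (Nat.le_ceil _).trans (by exact_mod_cast (by omega))
    rw [← Nat.cast_add_one, ← ENNReal.ofReal_natCast,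
      ← ENNReal.ofReal_inv_of_pos (by positivity)]
    refine ENNReal.ofReal_le_ofReal ?_
    rw [inv_le_comm₀ (by positivity) hη0, ← one_div]
    exact hle
  have hY : ∀ j : Fin (n + 1), n - n₂ ≤ j →
      μ {x | Mmax n n₂ (x, 0) < |(x j).2|} ≤ ENNReal.ofReal η := fun j hj => by
    refine le_trans (ENNReal.le_inv_iff_mul_le.2 ?_) hinv
    rw [mul_comm]
    exact measure_Mmax_lt_abs_le P 0 j hj
  have hmed : μ {x | Mmax n n₂ (x, 0) < |m (x (Fin.last n)).1|} ≤ 2 * ENNReal.ofReal η :=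
    (measure_Mmax_lt_abs_condMedian_le (by omega) (by omega) hm 0).trans <| by
      gcongr
      exact hY _ (by simp)
  let D : Fin n₂ → Set (Fin (n + 1) → (Fin d → ℝ) × ℝ) := fun j =>
    {x | Mmax n n₂ (x, 0) < |(x ⟨min (n - n₂ + j.1) n, by omega⟩).2|}
  let C : Set (Fin (n + 1) → (Fin d → ℝ) × ℝ) :=
    {x | Mmax n n₂ (x, 0) < |m (x (Fin.last n)).1|}
  let R : Set (Fin (n₂ + 1) → ℝ) := {z | k.toNat ≤ (Finset.univ.filter fun j =>
    j ≠ Fin.last n₂ ∧ |z j| ≤ |z (Fin.last n₂)| + δ).card}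
  have hcover : Set.univ ⊆
      Ev3 (2 / δ) k n n₂ m ∪ (((⋃ j, D j) ∪ C) ×ˢ Set.univ ∪ Set.univ ×ˢ R) := by
    rintro ω -
    by_contra hω
    simp only [Set.mem_union, Set.mem_prod, Set.mem_univ, and_true, true_and, Set.mem_iUnion,
      not_or, not_exists] at hω
    obtain ⟨hEv, ⟨hD, hC⟩, hR⟩ := hω
    refine hEv (mem_Ev3_of_not_le_card (by positivity) hk0 hkn (not_lt.1 hC)
      (fun j => not_lt.1 (hD j)) ?_)
    have hδ2 : 2 / (2 / δ) = δ := by field_simp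
    rw [hδ2]
    exact hR
  have hDC : μ ((⋃ j, D j) ∪ C) ≤ n₂ * ENNReal.ofReal η + 2 * ENNReal.ofReal η := by
    refine (measure_union_le _ _).trans (add_le_add ?_ hmed)
    refine (measure_iUnion_fintype_le _ _).trans ?_
    calc ∑ j, μ (D j) ≤ ∑ _j : Fin n₂, ENNReal.ofReal η :=
          Finset.sum_le_sum fun j _ => hY _ (by simp)
      _ = _ := by simp
  have hbad : (μ.prod ν) (((⋃ j, D j) ∪ C) ×ˢ Set.univ ∪ Set.univ ×ˢ R) ≤
      ENNReal.ofReal (α / 2 + ε) := by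
    calc _ ≤ μ ((⋃ j, D j) ∪ C) + ν R := by
          refine (measure_union_le _ _).trans ?_
          rw [Measure.prod_prod, Measure.prod_prod, measure_univ, measure_univ, mul_one, one_mul]
      _ ≤ (n₂ * ENNReal.ofReal η + 2 * ENNReal.ofReal η) + ENNReal.ofReal (α / 2 + ε / 2) :=
          add_le_add hDC hrankδ.le
      _ = ENNReal.ofReal (α / 2 + ε) := by
          rw [← add_mul, ← ENNReal.ofReal_natCast, ← ENNReal.ofReal_ofNat 2,
            ← ENNReal.ofReal_add (by positivity) (by positivity),
            ← ENNReal.ofReal_mul (by positivity),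
            ← ENNReal.ofReal_add (by positivity) (by positivity)]
          congr 1
          rw [hη]
          field_simp
          ring
  have hone : 1 ≤ (μ.prod ν) (Ev3 (2 / δ) k n n₂ m) + ENNReal.ofReal (α / 2 + ε) :=
    calc 1 = (μ.prod ν) Set.univ := measure_univ.symm
      _ ≤ _ := (measure_mono hcover).trans (measure_union_le _ _)
      _ ≤ _ := by gcongr
  rw [sub_sub, ENNReal.ofReal_sub _ (by positivity), ENNReal.ofReal_one, tsub_le_iff_right]
  exact hone
end

section
/- Let α ∈ (0,1), d, n ≥ 1, and let Ĉ be a map assigning to each ((x₁,y₁),…,(x_n,y_n), x) ∈ (ℝ^d × ℝ)^n × ℝ^d a subset Ĉ((x₁,y₁),…,(x_n,y_n); x) ⊆ ℝ, such that all coverage events appearing below are measurable. Suppose that Ĉ satisfies distribution-free median coverage at level 1−α: for every probability distribution Q on ℝ^d × ℝ, every conditional median function m_Q of Q, and (X₁,Y₁),…,(X_{n+1},Y_{n+1}) i.i.d. with law Q, one has ℙ( m_Q(X_{n+1}) ∈ Ĉ((X₁,Y₁),…,(X_n,Y_n); X_{n+1}) ) ≥ 1 − α. Then for every probability distribution P on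 ℝ^d × ℝ whose marginal on ℝ^d is nonatomic, with (X₁,Y₁),…,(X_{n+1},Y_{n+1}) i.i.d. with law P, one has ℙ( Y_{n+1} ∈ Ĉ((X₁,Y₁),…,(X_n,Y_n); X_{n+1}) ) ≥ 1 − α. -/
open MeasureTheory ProbabilityTheory
open scoped ENNReal NNReal

/-- Selecting distinct coordinates of an i.i.d. sample yields an i.i.d. sample. -/
theorem map_pi_comp_injective {ι κ Z : Type*} [Fintype ι] [Fintype κ] [MeasurableSpace Z]
    (μ : Measure Z) [IsProbabilityMeasure μ] {f : ι → κ} (hf : Function.Injective f) :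
    (Measure.pi fun _ : κ => μ).map (fun ω i => ω (f i)) = Measure.pi fun _ : ι => μ := by
  have h := (iIndepFun_pi (μ := fun _ : κ => μ) (X := fun _ => id)
    fun _ => aemeasurable_id).precomp hf
  refine (h.map_fun_eq_pi_map fun i => (measurable_pi_apply (f i)).aemeasurable).trans ?_
  congr 1
  ext1 i
  exact (measurePreserving_eval (fun _ : κ => μ) (f i)).map_eq

/-- The probability that a given pair of an i.i.d. sample collides under `g` is at most the
largest mass of a fibre of `g`. -/
theorem pi_collision_le {ι Z β : Type*} [Fintype ι] [MeasurableSpace Z] [MeasurableSpace β]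
    [MeasurableEq β] (μ : Measure Z) [IsProbabilityMeasure μ] {g : Z → β} (hg : Measurable g)
    {c : ℝ≥0∞} (hc : ∀ x, μ (g ⁻¹' {x}) ≤ c) {i j : ι} (hij : i ≠ j) :
    (Measure.pi fun _ : ι => μ) {ω | g (ω i) = g (ω j)} ≤ c := by
  have h := (iIndepFun_pi (μ := fun _ : ι => μ) (X := fun _ => id)
    fun _ => aemeasurable_id).indepFun hij |>.map_prod_eq_prod_map_map
      (measurable_pi_apply i).aemeasurable (measurable_pi_apply j).aemeasurable
  have hi : ∀ k : ι, (Measure.pi fun _ : ι => μ).map (fun ω => ω k) = μ :=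
    fun k => (measurePreserving_eval (fun _ : ι => μ) k).map_eq
  rw [hi, hi] at h
  have hs : MeasurableSet {z : Z × Z | g z.1 = g z.2} :=
    measurableSet_eq_fun (hg.comp measurable_fst) (hg.comp measurable_snd)
  calc (Measure.pi fun _ : ι => μ) {ω | g (ω i) = g (ω j)}
      = (μ.prod μ) {z : Z × Z | g z.1 = g z.2} := by
        rw [← h, Measure.map_apply (by fun_prop) hs]
        rfl
    _ = ∫⁻ z, μ (Prod.mk z ⁻¹' {z : Z × Z | g z.1 = g z.2}) ∂μ := Measure.prod_apply hs
    _ ≤ ∫⁻ _, c ∂μ := by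
        refine lintegral_mono fun z => (measure_mono ?_).trans (hc (g z))
        exact fun w hw => Eq.symm hw
    _ = c := by simp

/-- A union bound for the probability that an i.i.d. sample has a collision under `g`. -/
theorem pi_not_injective_le {ι Z β : Type*} [Fintype ι] [MeasurableSpace Z] [MeasurableSpace β]
    [MeasurableEq β] (μ : Measure Z) [IsProbabilityMeasure μ] {g : Z → β} (hg : Measurable g)
    {c : ℝ≥0∞} (hc : ∀ x, μ (g ⁻¹' {x}) ≤ c) :
    (Measure.pi fun _ : ι => μ) {ω | ¬ Function.Injective fun i => g (ω i)} ≤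
      (Fintype.card (ι × ι) : ℝ≥0∞) * c := by
  classical
  calc (Measure.pi fun _ : ι => μ) {ω | ¬ Function.Injective fun i => g (ω i)}
      ≤ (Measure.pi fun _ : ι => μ)
          (⋃ p : ι × ι, {ω | p.1 ≠ p.2 ∧ g (ω p.1) = g (ω p.2)}) := by
        refine measure_mono fun ω hω => ?_
        simp only [Function.Injective, Set.mem_ofPred_eq, not_forall] at hω
        obtain ⟨i, j, h, hij⟩ := hω
        exact Set.mem_iUnion.2 ⟨(i, j), hij, h⟩
    _ ≤ ∑ p : ι × ι, (Measure.pi fun _ : ι => μ) {ω | p.1 ≠ p.2 ∧ g (ω p.1) = g (ω p.2)} :=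
        measure_iUnion_fintype_le _ _
    _ ≤ ∑ _p : ι × ι, c := by
        refine Finset.sum_le_sum fun p _ => ?_
        by_cases hp : p.1 = p.2
        · simp [hp]
        · exact (measure_mono fun ω hω => hω.2).trans (pi_collision_le μ hg hc hp)
    _ = (Fintype.card (ι × ι) : ℝ≥0∞) * c := by simp

/-- If the response is almost surely a function of the features, then this function is a
conditional median. -/
theorem isCondMedian_of_ae_eq {d : ℕ} (Q : Measure ((Fin d → ℝ) × ℝ)) [IsFiniteMeasure Q]
    {m : (Fin d → ℝ) → ℝ} (hm : Measurable m) (h : ∀ᵐ z ∂Q, z.2 = m z.1) :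
    IsCondMedian Q m := by
  have hQ : Q = Q.fst ⊗ₘ Kernel.deterministic m hm := by
    rw [Measure.compProd_deterministic, Measure.fst, Measure.map_map (by fun_prop) (by fun_prop)]
    conv_lhs => rw [← Measure.map_id (μ := Q)]
    refine Measure.map_congr ?_
    filter_upwards [h] with z hz
    exact Prod.ext rfl hz
  refine ⟨hm, ?_⟩
  filter_upwards [eq_condKernel_of_measure_eq_compProd _ hQ] with x hx
  rw [← hx, Kernel.deterministic_apply]
  constructor <;> simp

/-- A finite set of points over distinct features is contained in the graph of a measurable
function. -/
theorem exists_measurable_interpolation {ι X : Type*} [Fintype ι] [MeasurableSpace X]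
    [MeasurableSingletonClass X] {x : ι → X} (hx : Function.Injective x) (y : ι → ℝ) :
    ∃ m : X → ℝ, Measurable m ∧ ∀ i, m (x i) = y i := by
  classical
  refine ⟨fun t => ∑ i, ({x i} : Set X).indicator (fun _ => y i) t,
    Finset.measurable_sum _ fun i _ =>
      measurable_const.indicator (measurableSet_singleton _), fun i => ?_⟩
  refine (Finset.sum_eq_single i ?_ ?_).trans (by simp)
  · intro j _ hj
    exact Set.indicator_of_notMem (fun h => hj (hx (Set.mem_singleton_iff.1 h)).symm) _
  · simp

/-- A bound comparing sampling with replacement from an i.i.d. sample `D` of size `k + 1`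
to sampling from the underlying distribution. -/
theorem le_pi_add_of_ae_le_pi_map_uniformOn {ι Z : Type*} [Fintype ι] [MeasurableSpace Z]
    (P : Measure Z) [IsProbabilityMeasure P] {A : Set (ι → Z)} (hA : MeasurableSet A)
    {a : ℝ≥0∞} (k : ℕ)
    (h : ∀ᵐ D ∂(Measure.pi fun _ : Fin (k + 1) => P),
      a ≤ (Measure.pi fun _ : ι => (uniformOn (Set.univ : Set (Fin (k + 1)))).map D) A) :
    a ≤ (Measure.pi fun _ : ι => P) A +
      (Fintype.card (ι × ι) : ℝ≥0∞) * ((k + 1 : ℕ) : ℝ≥0∞)⁻¹ := by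
  set U : Measure (Fin (k + 1)) := uniformOn Set.univ with hU
  set ν : Measure (ι → Fin (k + 1)) := Measure.pi fun _ => U
  set ρ : Measure (Fin (k + 1) → Z) := Measure.pi fun _ => P
  set B : Set (ι → Fin (k + 1)) := {f | ¬ Function.Injective f}
  have hjoint : Measurable fun p : (Fin (k + 1) → Z) × (ι → Fin (k + 1)) =>
      fun i => p.1 (p.2 i) :=
    measurable_from_prod_countable_left fun f => by fun_prop
  have hmap : ∀ D : Fin (k + 1) → Z, (Measure.pi fun _ : ι => U.map D) A =
      ν {f | (fun i => D (f i)) ∈ A} := by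
    intro D
    have hD : Measurable D := measurable_of_countable D
    have : IsProbabilityMeasure (U.map D) := Measure.isProbabilityMeasure_map hD.aemeasurable
    rw [← Measure.pi_map_pi (μ := fun _ : ι => U) (f := fun _ => D) fun _ => hD.aemeasurable,
      Measure.map_apply (by fun_prop) hA]
    rfl
  have hbad : ν B ≤ (Fintype.card (ι × ι) : ℝ≥0∞) * ((k + 1 : ℕ) : ℝ≥0∞)⁻¹ := by
    refine pi_not_injective_le U measurable_id fun x => ?_
    simp [hU, uniformOn_univ]
  have hf : ∀ f : ι → Fin (k + 1), ρ {D | (fun i => D (f i)) ∈ A} ≤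
      (Measure.pi fun _ : ι => P) A + B.indicator 1 f := by
    intro f
    by_cases hinj : Function.Injective f
    · rw [← map_pi_comp_injective P hinj, Measure.map_apply (by fun_prop) hA]
      exact le_self_add
    · rw [Set.indicator_of_mem (show f ∈ B from hinj)]
      exact prob_le_one.trans le_add_self
  calc a = ∫⁻ _, a ∂ρ := by simp
    _ ≤ ∫⁻ D, ν {f | (fun i => D (f i)) ∈ A} ∂ρ := by
        refine lintegral_mono_ae ?_
        filter_upwards [h] with D hD
        rwa [← hmap]
    _ = ∫⁻ f, ρ {D | (fun i => D (f i)) ∈ A} ∂ν :=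
        (Measure.prod_apply (hjoint hA)).symm.trans (Measure.prod_apply_symm (hjoint hA))
    _ ≤ ∫⁻ f, ((Measure.pi fun _ : ι => P) A + B.indicator 1 f) ∂ν := lintegral_mono hf
    _ = (Measure.pi fun _ : ι => P) A + ν B := by
        rw [lintegral_add_left measurable_const,
          lintegral_indicator_one B.toFinite.measurableSet]
        simp
    _ ≤ _ := by gcongr

/-- **Theorem 3.1**: any algorithm with distribution-free conditional median coverage
`1 - α` also has predictive coverage `1 - α` for every distribution whose feature
marginal is nonatomic.  Datapoints are indexed by `Fin (n + 1)`, the last one being the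
test point. -/
theorem statement_4 {d n : ℕ} (hd : 1 ≤ d) (hn : 1 ≤ n) {α : ℝ} (hα : α ∈ Set.Ioo (0 : ℝ) 1)
    (C : (Fin n → ((Fin d → ℝ) × ℝ)) → (Fin d → ℝ) → Set ℝ)
    (hmeasMed : ∀ m : (Fin d → ℝ) → ℝ, Measurable m →
      MeasurableSet {ω : Fin (n + 1) → ((Fin d → ℝ) × ℝ) |
        m (ω (Fin.last n)).1 ∈ C (fun i => ω i.castSucc) (ω (Fin.last n)).1})
    (hmeasPred : MeasurableSet {ω : Fin (n + 1) → ((Fin d → ℝ) × ℝ) |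
      (ω (Fin.last n)).2 ∈ C (fun i => ω i.castSucc) (ω (Fin.last n)).1})
    (hcov : ∀ (Q : Measure ((Fin d → ℝ) × ℝ)) [IsProbabilityMeasure Q],
      ∀ m : (Fin d → ℝ) → ℝ, IsCondMedian Q m →
        ENNReal.ofReal (1 - α) ≤
          (Measure.pi fun _ : Fin (n + 1) => Q)
            {ω | m (ω (Fin.last n)).1 ∈ C (fun i => ω i.castSucc) (ω (Fin.last n)).1})
    (P : Measure ((Fin d → ℝ) × ℝ)) [IsProbabilityMeasure P]
    (hP : ∀ x : Fin d → ℝ, P.fst {x} = 0) :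
    ENNReal.ofReal (1 - α) ≤
      (Measure.pi fun _ : Fin (n + 1) => P)
        {ω | (ω (Fin.last n)).2 ∈ C (fun i => ω i.castSucc) (ω (Fin.last n)).1} := by
  set A : Set (Fin (n + 1) → ((Fin d → ℝ) × ℝ)) :=
    {ω | (ω (Fin.last n)).2 ∈ C (fun i => ω i.castSucc) (ω (Fin.last n)).1}
  have hbound : ∀ k : ℕ, ENNReal.ofReal (1 - α) ≤ (Measure.pi fun _ : Fin (n + 1) => P) A +
      (Fintype.card (Fin (n + 1) × Fin (n + 1)) : ℝ≥0∞) * ((k + 1 : ℕ) : ℝ≥0∞)⁻¹ := by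
    intro k
    refine le_pi_add_of_ae_le_pi_map_uniformOn P hmeasPred k ?_
    have hdistinct : ∀ᵐ D ∂(Measure.pi fun _ : Fin (k + 1) => P),
        Function.Injective fun i => (D i).1 := by
      refine le_antisymm ((pi_not_injective_le P measurable_fst (c := 0) fun x => ?_).trans
        (by simp)) zero_le
      rw [← Measure.fst_apply (measurableSet_singleton x), hP]
    filter_upwards [hdistinct] with D hD
    obtain ⟨m, hm, hmD⟩ := exists_measurable_interpolation hD fun i => (D i).2
    have hDm : Measurable D := measurable_of_countable D
    set Q := (uniformOn (Set.univ : Set (Fin (k + 1)))).map D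
    have : IsProbabilityMeasure Q := Measure.isProbabilityMeasure_map hDm.aemeasurable
    have hae : ∀ᵐ z ∂Q, z.2 = m z.1 :=
      (ae_map_iff hDm.aemeasurable
        (measurableSet_eq_fun measurable_snd (hm.comp measurable_fst))).2
          (.of_forall fun i => (hmD i).symm)
    refine (hcov Q m (isCondMedian_of_ae_eq Q hm hae)).trans (measure_mono_ae ?_)
    filter_upwards [(Measure.quasiMeasurePreserving_eval (fun _ : Fin (n + 1) => Q)
      (Fin.last n)).ae hae] with ω hω hmem
    simp only [Function.eval] at hω
    change (ω (Fin.last n)).2 ∈ C _ _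
    rw [hω]
    exact hmem
  have hlim : Filter.Tendsto (fun k : ℕ => (Measure.pi fun _ : Fin (n + 1) => P) A +
      (Fintype.card (Fin (n + 1) × Fin (n + 1)) : ℝ≥0∞) * ((k + 1 : ℕ) : ℝ≥0∞)⁻¹)
      Filter.atTop (nhds ((Measure.pi fun _ : Fin (n + 1) => P) A +
        (Fintype.card (Fin (n + 1) × Fin (n + 1)) : ℝ≥0∞) * 0)) :=
    tendsto_const_nhds.add (ENNReal.Tendsto.const_mul
      (ENNReal.tendsto_inv_nat_nhds_zero.comp (Filter.tendsto_add_atTop_nat 1))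
      (.inr (ENNReal.natCast_ne_top _)))
  rw [mul_zero, add_zero] at hlim
  exact ge_of_tendsto' hlim hbound
end
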